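/- Let n ≥ 2. There exist positive constants c₂, C₂, C₃ depending only on n such that the following holds. Let L > 0 and let u be strictly convex and C² on the closure of the section S := S(u, L) = {z : u(z) < u(0) + L}, with B₁(ξ) ⊆ S ⊆ B_n(ξ) for some ξ ∈ ℝⁿ, D u(0) = 0, u = 0 on ∂S, and (det D²u)^{1/n} = g in S with g(0) = 1 and δ := sup_S |g − 1| ≤ n^{−2}/5. Let w be convex, smooth in S and continuous on S̄, with det D²w = 1 in S and w = 0 on ∂S. Then: (a) |u − w| ≤ n²δ/2 on S; (b) c₂ I ≤ D²w(x) ≤ C₂ I for all x ∈ S(u, L/2); (c) for every α ∈ [0,1], sup_{x ≠ y ∈ S(u,L/2)} |D²w(x) − D²w(y)|/|x − y|^α ≤ C₂^{1−α} C₃^{α}; (d) |D w(0)| ≤ n C₂ (2/c₂)^{1/2} δ^{1/2}. -/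

import Mathlib

open scoped RealInnerProductSpace
noncomputable section

abbrev Euc (n : ℕ) := EuclideanSpace ℝ (Fin n)

/-- Hessian matrix of `u` at `x`. -/
def hessianMatrix {n : ℕ} (u : Euc n → ℝ) (x : Euc n) : Matrix (Fin n) (Fin n) ℝ :=
  Matrix.of fun i j =>
    iteratedFDeriv ℝ 2 u x ![EuclideanSpace.single i 1, EuclideanSpace.single j 1]

/-- Determinant of the Hessian of `u` at `x`. -/
def hessDet {n : ℕ} (u : Euc n → ℝ) (x : Euc n) : ℝ := (hessianMatrix u x).det


namespace SPF
open Matrix Filter Topology Set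

lemma spectral_real {n : ℕ} (A : Matrix (Fin n) (Fin n) ℝ) (hA : A.IsHermitian) :
    ∃ (U : Matrix (Fin n) (Fin n) ℝ) (l : Fin n → ℝ), Uᵀ * U = 1 ∧ Uᵀ * A * U = diagonal l := by
  refine ⟨(hA.eigenvectorUnitary).1, hA.eigenvalues, ?_, ?_⟩
  · have := (hA.eigenvectorUnitary).2
    rw [Matrix.mem_unitaryGroup_iff'] at this
    simpa [star_eq_conjTranspose, conjTranspose_eq_transpose_of_trivial] using this
  · have h1 := hA.spectral_theorem
    have h2 := (hA.eigenvectorUnitary).2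
    rw [Matrix.mem_unitaryGroup_iff'] at h2
    rw [Unitary.conjStarAlgAut_apply] at h1
    set U : Matrix (Fin n) (Fin n) ℝ := (hA.eigenvectorUnitary : Matrix (Fin n) (Fin n) ℝ)
    have h3 : star U = Uᵀ := by
      simp [star_eq_conjTranspose, conjTranspose_eq_transpose_of_trivial]
    have h4 : A = U * diagonal hA.eigenvalues * Uᵀ := by
      rw [← h3]; exact h1
    rw [h3] at h2
    conv_lhs => rw [h4]
    calc Uᵀ * (U * diagonal hA.eigenvalues * Uᵀ) * U
        = (Uᵀ * U) * diagonal hA.eigenvalues * (Uᵀ * U) := by simp only [Matrix.mul_assoc]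
      _ = _ := by rw [h2]; simp

lemma simul_diag {n : ℕ} (G A : Matrix (Fin n) (Fin n) ℝ) (hG : G.PosDef) (hA : A.IsHermitian) :
    ∃ (V : Matrix (Fin n) (Fin n) ℝ) (l : Fin n → ℝ), Vᵀ * G * V = 1 ∧ Vᵀ * A * V = diagonal l := by
  obtain ⟨U, d, hU, hUG⟩ := spectral_real G hG.isHermitian
  have hd : ∀ i, 0 < d i := by
    intro i
    have hUinj : Function.Injective U.mulVec := by
      intro x y hxy
      have : Uᵀ *ᵥ (U *ᵥ x) = Uᵀ *ᵥ (U *ᵥ y) := by rw [hxy]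
      simpa [Matrix.mulVec_mulVec, hU] using this
    have h1 : (Uᴴ * G * U).PosDef := hG.conjTranspose_mul_mul_same hUinj
    rw [conjTranspose_eq_transpose_of_trivial, hUG] at h1
    have := h1.diag_pos (i := i)
    simpa using this
  set D : Matrix (Fin n) (Fin n) ℝ := diagonal (fun i => (Real.sqrt (d i))⁻¹) with hD
  have hDt : Dᵀ = D := by simp [hD]
  have hT : (U * D)ᵀ * G * (U * D) = 1 := by
    calc (U * D)ᵀ * G * (U * D) = D * (Uᵀ * G * U) * D := by
          rw [transpose_mul, hDt]; simp only [Matrix.mul_assoc]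
      _ = 1 := by
          rw [hUG, hD, diagonal_mul_diagonal, diagonal_mul_diagonal, ← diagonal_one]
          congr 1; ext i
          have := Real.sqrt_pos.2 (hd i)
          have h2 := Real.mul_self_sqrt (hd i).le
          field_simp
          rw [sq]; exact h2.symm
  have hA2 : ((U * D)ᵀ * A * (U * D)).IsHermitian := by
    unfold Matrix.IsHermitian at *
    rw [conjTranspose_eq_transpose_of_trivial] at *
    simp only [transpose_mul, transpose_transpose, hA, Matrix.mul_assoc]
  obtain ⟨W, l, hW, hWl⟩ := spectral_real _ hA2
  refine ⟨U * D * W, l, ?_, ?_⟩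
  · calc (U * D * W)ᵀ * G * (U * D * W) = Wᵀ * ((U * D)ᵀ * G * (U * D)) * W := by
          rw [transpose_mul (U * D)]; simp only [Matrix.mul_assoc]
      _ = 1 := by rw [hT]; simpa using hW
  · rw [← hWl, transpose_mul (U * D)]; simp only [Matrix.mul_assoc]

lemma det_of_diag {n : ℕ} {V A : Matrix (Fin n) (Fin n) ℝ} {l : Fin n → ℝ}
    (h : Vᵀ * A * V = diagonal l) : V.det ^ 2 * A.det = ∏ i, l i := by
  have := congrArg Matrix.det h
  rw [det_mul, det_mul, det_transpose, det_diagonal] at this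
  rw [← this]; ring

lemma det_of_one {n : ℕ} {V A : Matrix (Fin n) (Fin n) ℝ}
    (h : Vᵀ * A * V = 1) : V.det ^ 2 * A.det = 1 := by
  have := congrArg Matrix.det h
  rw [det_mul, det_mul, det_transpose, det_one] at this
  rw [← this]; ring

lemma diag_of_posSemidef {n : ℕ} {V A : Matrix (Fin n) (Fin n) ℝ} 
    (hA : A.PosSemidef) (i : Fin n) : 0 ≤ (Vᵀ * A * V) i i := by
  have h1 := hA.conjTranspose_mul_mul_same V
  rw [conjTranspose_eq_transpose_of_trivial] at h1
  exact h1.diag_nonneg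

lemma det_mono {n : ℕ} {N H : Matrix (Fin n) (Fin n) ℝ} (hN : N.PosDef)
    (h : (H - N).PosSemidef) : N.det ≤ H.det := by
  have hH : H.IsHermitian := by
    have := h.isHermitian.add hN.isHermitian
    simpa using this
  obtain ⟨V, l, h1, h2⟩ := simul_diag N H hN hH
  have hl : ∀ i, 1 ≤ l i := by
    intro i
    have h3 := diag_of_posSemidef (V := V) h i
    rw [Matrix.mul_sub, Matrix.sub_mul, h1, h2] at h3
    simpa using h3
  have e1 := det_of_one h1
  have e2 := det_of_diag h2
  have h3 : 1 ≤ ∏ i, l i := by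
    have := Finset.prod_le_prod (s := Finset.univ) (f := fun _ : Fin n => (1 : ℝ)) (g := l)
      (fun _ _ => zero_le_one) (fun i _ => hl i)
    simpa using this
  have hV : 0 < V.det ^ 2 := by
    rcases (sq_nonneg V.det).lt_or_eq with h | h
    · exact h
    · rw [← h] at e1; simp at e1
  nlinarith

lemma det_add_lt {n : ℕ} (hn : 0 < n) {N : Matrix (Fin n) (Fin n) ℝ} (hN : N.PosSemidef)
    {ε : ℝ} (hε : 0 < ε) : N.det < (N + ε • (1 : Matrix (Fin n) (Fin n) ℝ)).det := by
  have hP : (N + ε • (1 : Matrix (Fin n) (Fin n) ℝ)).PosDef :=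
    Matrix.PosDef.posSemidef_add hN (Matrix.PosDef.one.smul hε)
  obtain ⟨V, l, h1, h2⟩ := simul_diag _ N hP hN.isHermitian
  have hS : (ε • (1 : Matrix (Fin n) (Fin n) ℝ)).PosDef := Matrix.PosDef.one.smul hε
  have e1 := det_of_one h1
  have e2 := det_of_diag h2
  have hV : V.det ≠ 0 := by
    intro h; rw [h] at e1; simp at e1
  have hVinj : Function.Injective V.mulVec := by
    exact Matrix.mulVec_injective_iff_isUnit.2 ((Matrix.isUnit_iff_isUnit_det _).2 (isUnit_iff_ne_zero.2 hV))
  have hl0 : ∀ i, 0 ≤ l i := by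
    intro i
    have := diag_of_posSemidef (V := V) hN i
    rw [h2] at this; simpa using this
  have hl : ∀ i, l i < 1 := by
    intro i
    have h3 := (hS.conjTranspose_mul_mul_same hVinj).diag_pos (i := i)
    rw [conjTranspose_eq_transpose_of_trivial] at h3
    rw [Matrix.mul_add, Matrix.add_mul, h2] at h1
    have h4 := congrFun (congrFun h1 i) i
    simp only [Matrix.add_apply, diagonal_apply_eq, one_apply_eq] at h4
    linarith
  have hprod : ∏ i, l i < 1 := by
    have i0 : Fin n := ⟨0, hn⟩
    calc ∏ i, l i = l i0 * ∏ i ∈ Finset.univ.erase i0, l i :=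
          (Finset.mul_prod_erase _ _ (Finset.mem_univ i0)).symm
      _ ≤ l i0 * 1 := by
          apply mul_le_mul_of_nonneg_left _ (hl0 i0)
          exact Finset.prod_le_one (fun i _ => hl0 i) (fun i _ => (hl i).le)
      _ < 1 := by simpa using hl i0
  have hV2 : 0 < V.det ^ 2 := by positivity
  nlinarith

lemma psd_lower {n : ℕ} {H : Matrix (Fin n) (Fin n) ℝ} (hH : H.PosSemidef) (hdet : H.det = 1)
    {C : ℝ} (hC : 0 < C) (h : (C • (1 : Matrix (Fin n) (Fin n) ℝ) - H).PosSemidef) :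
    (H - (C ^ (n - 1))⁻¹ • (1 : Matrix (Fin n) (Fin n) ℝ)).PosSemidef := by
  obtain ⟨V, l, h1, h2⟩ := simul_diag 1 H Matrix.PosDef.one hH.isHermitian
  rw [Matrix.mul_one] at h1
  have h1' : V * Vᵀ = 1 := mul_eq_one_comm.1 h1
  have hl0 : ∀ i, 0 ≤ l i := by
    intro i
    have := diag_of_posSemidef (V := V) hH i
    rw [h2] at this; simpa using this
  have hlC : ∀ i, l i ≤ C := by
    intro i
    have h3 := diag_of_posSemidef (V := V) h i
    rw [Matrix.mul_sub, Matrix.sub_mul, h2] at h3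
    simp [h1] at h3
    exact h3
  have hp : ∏ i, l i = 1 := by
    have e2 := det_of_diag h2
    have e1 := det_of_one (V := V) (A := 1) (by rw [Matrix.mul_one]; exact h1)
    rw [det_one, mul_one] at e1
    rw [e1, hdet] at e2; linarith
  have hl : ∀ i, (C ^ (n - 1))⁻¹ ≤ l i := by
    intro i
    have h3 : l i * ∏ j ∈ Finset.univ.erase i, l j = 1 := by
      rw [Finset.mul_prod_erase _ _ (Finset.mem_univ i)]; exact hp
    have h4 : ∏ j ∈ Finset.univ.erase i, l j ≤ C ^ (n - 1) := by
      calc _ ≤ ∏ j ∈ Finset.univ.erase i, C :=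
            Finset.prod_le_prod (fun j _ => hl0 j) (fun j _ => hlC j)
        _ = _ := by simp [Finset.card_erase_of_mem]
    rw [inv_le_iff_one_le_mul₀ (by positivity), ← h3]
    exact mul_le_mul_of_nonneg_left h4 (hl0 i)
  have hHd : H - (C ^ (n - 1))⁻¹ • (1 : Matrix (Fin n) (Fin n) ℝ)
      = V * diagonal (fun i => l i - (C ^ (n - 1))⁻¹) * Vᵀ := by
    have : diagonal (fun i => l i - (C ^ (n - 1))⁻¹)
        = Vᵀ * (H - (C ^ (n - 1))⁻¹ • (1 : Matrix (Fin n) (Fin n) ℝ)) * V := by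
      rw [Matrix.mul_sub, Matrix.sub_mul, h2]
      simp only [Matrix.mul_smul, Matrix.smul_mul, Matrix.mul_one, h1]
      ext i j
      by_cases hij : i = j <;> simp [diagonal_apply, one_apply, hij]
    rw [this]
    calc _ = 1 * (H - (C ^ (n - 1))⁻¹ • (1 : Matrix (Fin n) (Fin n) ℝ)) * 1 := by simp
      _ = _ := by rw [← h1']; simp only [Matrix.mul_assoc]
  rw [hHd]
  have := (Matrix.PosSemidef.diagonal (d := fun i => l i - (C ^ (n - 1))⁻¹)
    (fun i => sub_nonneg.2 (hl i))).mul_mul_conjTranspose_same V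
  rwa [conjTranspose_eq_transpose_of_trivial] at this

lemma det_rank_one {n : ℕ} (hn : 0 < n) {a A : ℝ} (ha : a ≠ 0) (ν : Fin n → ℝ)
    (hν : ν ⬝ᵥ ν = 1) :
    (a • (1 : Matrix (Fin n) (Fin n) ℝ) + A • vecMulVec ν ν).det = a ^ (n - 1) * (a + A) := by
  have h1 : a • (1 : Matrix (Fin n) (Fin n) ℝ) + A • vecMulVec ν ν
      = a • (1 + replicateCol Unit ((A / a) • ν) * replicateRow Unit ν) := by
    ext i j
    simp [vecMulVec_apply, Matrix.mul_apply]
    field_simp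
  rw [h1, det_smul, det_one_add_replicateCol_mul_replicateRow, dotProduct_smul, hν]
  simp only [Fintype.card_fin, smul_eq_mul, mul_one]
  obtain ⟨m, rfl⟩ : ∃ m, n = m + 1 := ⟨n - 1, by omega⟩
  simp [pow_succ]
  field_simp

lemma second_deriv_test {φ φ1 : ℝ → ℝ} {c : ℝ} (h : IsLocalMax φ 0)
    (h1 : ∀ᶠ t in 𝓝 0, HasDerivAt φ (φ1 t) t) (h2 : HasDerivAt φ1 c 0) : φ1 0 = 0 ∧ c ≤ 0 := by
  have h10 : φ1 0 = 0 := h.hasDerivAt_eq_zero h1.self_of_nhds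
  refine ⟨h10, ?_⟩
  by_contra hc
  push Not at hc
  have hd : deriv φ =ᶠ[𝓝 0] φ1 := h1.mono fun t ht => ht.deriv
  have hdd : deriv (deriv φ) 0 = c := by rw [hd.deriv_eq]; exact h2.deriv
  have hmin : IsLocalMin φ 0 := isLocalMin_of_deriv_deriv_pos (by rw [hdd]; exact hc)
    (by rw [hd.self_of_nhds]; exact h10) h1.self_of_nhds.continuousAt
  have hconst : φ =ᶠ[𝓝 0] fun _ => φ 0 := by
    filter_upwards [h, hmin] with t ht1 ht2
    exact le_antisymm ht1 ht2
  have h3 : deriv φ =ᶠ[𝓝 0] fun _ => 0 := by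
    have := hconst.deriv
    simpa using this
  have : deriv (deriv φ) 0 = 0 := by rw [h3.deriv_eq]; simp
  linarith

end SPF

namespace SPF
open Matrix Filter Topology Set

section detjet
attribute [local instance] Matrix.linftyOpNormedRing
attribute [local instance] Matrix.linftyOpNormedAlgebra

lemma differentiable_entry {n : ℕ} (i j : Fin n) :
    Differentiable ℝ (fun M : Matrix (Fin n) (Fin n) ℝ => M i j) :=
  (LinearMap.toContinuousLinearMap (Matrix.entryLinearMap ℝ ℝ i j)).differentiable

lemma differentiable_det {n : ℕ} :
    Differentiable ℝ (fun M : Matrix (Fin n) (Fin n) ℝ => M.det) := by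
  simp only [Matrix.det_apply]
  refine Differentiable.fun_sum fun σ _ => ?_
  refine Differentiable.const_smul ?_ _
  intro M
  exact (HasFDerivAt.finsetProd (u := Finset.univ)
    (g := fun (i : Fin n) (M : Matrix (Fin n) (Fin n) ℝ) => M (σ i) i)
    fun i _ => (differentiable_entry (σ i) i M).hasFDerivAt).differentiableAt

lemma hasDerivAt_matrix {n : ℕ} {N : ℝ → Matrix (Fin n) (Fin n) ℝ} {N' : Matrix (Fin n) (Fin n) ℝ}
    {t : ℝ} (h : ∀ i j, HasDerivAt (fun s => N s i j) (N' i j) t) : HasDerivAt N N' t := by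
  have h1 : N = fun s => ∑ i, ∑ j, N s i j • Matrix.single i j (1 : ℝ) := by
    funext s
    conv_lhs => rw [Matrix.matrix_eq_sum_single (N s)]
    simp
  have h2 : N' = ∑ i, ∑ j, N' i j • Matrix.single i j (1 : ℝ) := by
    conv_lhs => rw [Matrix.matrix_eq_sum_single N']
    simp
  rw [h1, h2]
  exact HasDerivAt.fun_sum fun i _ => HasDerivAt.fun_sum fun j _ => (h i j).smul_const _

lemma hasDerivAt_trace {n : ℕ} {N : ℝ → Matrix (Fin n) (Fin n) ℝ} {N' : Matrix (Fin n) (Fin n) ℝ}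
    {t : ℝ} (h : HasDerivAt N N' t) : HasDerivAt (fun s => (N s).trace) N'.trace t :=
  ((LinearMap.toContinuousLinearMap (Matrix.traceLinearMap (Fin n) ℝ ℝ)).hasFDerivAt
    (x := N t)).comp_hasDerivAt t h

lemma hasDerivAt_det {n : ℕ} {N : ℝ → Matrix (Fin n) (Fin n) ℝ} {N' : Matrix (Fin n) (Fin n) ℝ}
    {t : ℝ} (h : HasDerivAt N N' t) (hd : (N t).det = 1) :
    HasDerivAt (fun s => (N s).det) ((Ring.inverse (N t) * N').trace) t := by
  have hu : IsUnit (N t) := (Matrix.isUnit_iff_isUnit_det _).2 (by rw [hd]; exact isUnit_one)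
  set J := Ring.inverse (N t) with hJ
  have hJN : N t * J = 1 := Ring.mul_inverse_cancel _ hu
  have h1 := (differentiable_det (n := n) (N t)).hasFDerivAt.comp_hasDerivAt t h
  refine h1.congr_deriv ?_
  have h2 : HasDerivAt (fun s : ℝ => N t + s • N') N' 0 := by
    have := ((hasDerivAt_id (0 : ℝ)).smul_const N').const_add (N t)
    refine this.congr_deriv (by simp)
  have h3 := (differentiable_det (n := n) (N t + (0 : ℝ) • N')).hasFDerivAt.comp_hasDerivAt (0 : ℝ) h2
  have h4 : ((fun M : Matrix (Fin n) (Fin n) ℝ => M.det) ∘ fun s : ℝ => N t + s • N')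
      = fun s : ℝ => ((1 + (Polynomial.X : Polynomial ℝ) •
          (J * N').map Polynomial.C).det).eval s := by
    funext s
    have e1 : N t + s • N' = N t * (1 + s • (J * N')) := by
      rw [Matrix.mul_add, Matrix.mul_one, Matrix.mul_smul, ← Matrix.mul_assoc, hJN, Matrix.one_mul]
    simp only [Function.comp]
    rw [e1, det_mul, hd, one_mul, ← Polynomial.coe_evalRingHom, RingHom.map_det]
    congr 1
    ext i j
    by_cases hij : i = j <;> simp [hij, -Matrix.map_mul] <;> ring
  rw [h4] at h3
  have h5 := (Polynomial.hasDerivAt ((1 + (Polynomial.X : Polynomial ℝ) •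
          (J * N').map Polynomial.C).det) (0 : ℝ))
  rw [derivative_det_one_add_X_smul] at h5
  have := h3.unique h5
  simpa using this

lemma hasDerivAt_inverse {n : ℕ} {N : ℝ → Matrix (Fin n) (Fin n) ℝ} {N' : Matrix (Fin n) (Fin n) ℝ}
    {t : ℝ} (h : HasDerivAt N N' t) (hd : (N t).det = 1) :
    HasDerivAt (fun s => Ring.inverse (N s)) (-(Ring.inverse (N t) * N' * Ring.inverse (N t))) t := by
  have hu : IsUnit (N t) := (Matrix.isUnit_iff_isUnit_det _).2 (by rw [hd]; exact isUnit_one)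
  obtain ⟨x, hx⟩ := hu
  have h1 := hasFDerivAt_ringInverse (𝕜 := ℝ) x
  rw [hx] at h1
  have h2 := h1.comp_hasDerivAt t h
  refine h2.congr_deriv ?_
  rw [← hx, Ring.inverse_unit]
  simp

lemma det_jet {n : ℕ} {N N1 N2 : ℝ → Matrix (Fin n) (Fin n) ℝ} {N3 : Matrix (Fin n) (Fin n) ℝ}
    (h0 : N 0 = 1)
    (h1 : ∀ᶠ t in 𝓝 0, ∀ i j, HasDerivAt (fun s => N s i j) (N1 t i j) t)
    (h2 : ∀ᶠ t in 𝓝 0, ∀ i j, HasDerivAt (fun s => N1 s i j) (N2 t i j) t)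
    (h3 : ∀ i j, HasDerivAt (fun s => N2 s i j) (N3 i j) 0)
    (hd : ∀ᶠ t in 𝓝 0, (N t).det = 1) :
    (N1 0).trace = 0 ∧ (N2 0).trace = (N1 0 * N1 0).trace ∧
    N3.trace = 3 * (N1 0 * N2 0).trace - 2 * (N1 0 * N1 0 * N1 0).trace := by
  have H1 : ∀ᶠ t in 𝓝 0, HasDerivAt N (N1 t) t := h1.mono fun t ht => hasDerivAt_matrix ht
  have H2 : ∀ᶠ t in 𝓝 0, HasDerivAt N1 (N2 t) t := h2.mono fun t ht => hasDerivAt_matrix ht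
  have H3 : HasDerivAt N2 N3 0 := hasDerivAt_matrix h3
  have zero_deriv : ∀ {f f' : ℝ → ℝ}, (∀ᶠ t in 𝓝 (0 : ℝ), f t = 0) →
      (∀ᶠ t in 𝓝 (0 : ℝ), HasDerivAt f (f' t) t) → ∀ᶠ t in 𝓝 (0 : ℝ), f' t = 0 := by
    intro f f' ha hb
    filter_upwards [ha.eventually_nhds, hb] with t ht1 ht2
    have : HasDerivAt f 0 t := (hasDerivAt_const t (0 : ℝ)).congr_of_eventuallyEq ht1
    exact ht2.unique this
  have A1 : ∀ᶠ t in 𝓝 (0 : ℝ), (Ring.inverse (N t) * N1 t).trace = 0 := by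
    have ha : ∀ᶠ t in 𝓝 (0 : ℝ), (N t).det - 1 = 0 := hd.mono fun t ht => by rw [ht]; ring
    refine zero_deriv ha ?_
    filter_upwards [H1, hd] with t ht1 ht2
    exact (hasDerivAt_det ht1 ht2).sub_const 1
  have A2 : ∀ᶠ t in 𝓝 (0 : ℝ), (-(Ring.inverse (N t) * N1 t * Ring.inverse (N t)) * N1 t
      + Ring.inverse (N t) * N2 t).trace = 0 := by
    refine zero_deriv A1 ?_
    filter_upwards [H1, H2, hd] with t ht1 ht2 ht3
    exact hasDerivAt_trace ((hasDerivAt_inverse ht1 ht3).mul ht2)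
  have i0 : Ring.inverse (N 0) = 1 := by rw [h0]; exact Ring.inverse_one _
  have A3 := hasDerivAt_inverse H1.self_of_nhds hd.self_of_nhds
  have A4 := H2.self_of_nhds
  have A5 := hasDerivAt_trace ((((A3.mul A4).mul A3).neg.mul A4).add (A3.mul H3))
  have A6 : HasDerivAt (fun _ : ℝ => (0 : ℝ)) _ 0 := A5.congr_of_eventuallyEq
    (A2.mono fun t ht => by simpa using ht.symm)
  have A7 := A6.unique (hasDerivAt_const 0 (0 : ℝ))
  have B1 := A1.self_of_nhds
  have B2 := A2.self_of_nhds
  simp only [i0, Matrix.one_mul, Matrix.mul_one] at B1 B2 A7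
  refine ⟨B1, ?_, ?_⟩
  · simp at B2; linarith
  · have e1 : (N2 0 * N1 0).trace = (N1 0 * N2 0).trace := Matrix.trace_mul_comm _ _
    simp only [Pi.mul_apply, i0, Pi.neg_apply, Matrix.one_mul, Matrix.mul_one, Matrix.add_mul, Matrix.neg_mul, Matrix.mul_neg, Matrix.mul_add,
      Matrix.trace_add, Matrix.trace_neg, Matrix.mul_assoc, neg_add, e1] at A7 ⊢
    linarith

end detjet
end SPF

namespace SPF
open Matrix Filter Topology Set

/-- directional derivative -/
def dd {n : ℕ} (v : Euc n) (f : Euc n → ℝ) (x : Euc n) : ℝ := fderiv ℝ f x v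

/-- Hessian as a bilinear form -/
def hs {n : ℕ} (f : Euc n → ℝ) (x : Euc n) : Euc n →L[ℝ] Euc n →L[ℝ] ℝ := fderiv ℝ (fderiv ℝ f) x

/-- matrix of a bilinear form in the standard basis -/
def bm {n : ℕ} (B : Euc n →L[ℝ] Euc n →L[ℝ] ℝ) : Matrix (Fin n) (Fin n) ℝ :=
  Matrix.of fun i j => B (EuclideanSpace.single i 1) (EuclideanSpace.single j 1)

lemma hessianMatrix_eq {n : ℕ} (f : Euc n → ℝ) (x : Euc n) : hessianMatrix f x = bm (hs f x) := by
  ext i j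
  simp [hessianMatrix, bm, hs, iteratedFDeriv_two_apply]

lemma vec_sum {n : ℕ} (a : Euc n) : a = ∑ i, a i • EuclideanSpace.single i (1 : ℝ) := by
  have := (EuclideanSpace.basisFun (Fin n) ℝ).sum_repr a
  simpa using this.symm

lemma bilin_eq {n : ℕ} (B : Euc n →L[ℝ] Euc n →L[ℝ] ℝ) (a b : Euc n) :
    B a b = (fun i => a i) ⬝ᵥ (bm B *ᵥ (fun i => b i)) := by
  conv_lhs => rw [vec_sum a, vec_sum b]
  simp only [map_sum, map_smul, ContinuousLinearMap.sum_apply, ContinuousLinearMap.smul_apply,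
    smul_eq_mul, dotProduct, mulVec, bm, of_apply, Finset.mul_sum]
  rw [Finset.sum_comm]
  refine Finset.sum_congr rfl fun i _ => Finset.sum_congr rfl fun j _ => ?_
  ring

lemma bm_symm {n : ℕ} {B : Euc n →L[ℝ] Euc n →L[ℝ] ℝ} (h : ∀ a b, B a b = B b a) :
    (bm B).IsHermitian := by
  unfold Matrix.IsHermitian
  ext i j
  simp [bm, h (EuclideanSpace.single j 1)]

lemma bm_psd {n : ℕ} {B : Euc n →L[ℝ] Euc n →L[ℝ] ℝ} (h : ∀ a b, B a b = B b a)
    (hp : ∀ a, 0 ≤ B a a) : (bm B).PosSemidef := by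
  refine .of_dotProduct_mulVec_nonneg (bm_symm h) fun x => ?_
  have := hp (WithLp.toLp 2 x)
  rw [bilin_eq] at this
  simpa using this

lemma bm_pd {n : ℕ} {B : Euc n →L[ℝ] Euc n →L[ℝ] ℝ} (h : ∀ a b, B a b = B b a)
    (hp : ∀ a, a ≠ 0 → 0 < B a a) : (bm B).PosDef := by
  refine .of_dotProduct_mulVec_pos (bm_symm h) fun x hx => ?_
  have := hp (WithLp.toLp 2 x) (by simpa using hx)
  rw [bilin_eq] at this
  simpa using this

lemma pos_of_bm {n : ℕ} {B : Euc n →L[ℝ] Euc n →L[ℝ] ℝ} (h : (bm B).PosDef) {a : Euc n}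
    (ha : a ≠ 0) : 0 < B a a := by
  rw [bilin_eq]
  have := h.dotProduct_mulVec_pos (x := fun i => a i) (by
    intro h; apply ha; ext i; simpa using congrFun h i)
  simpa using this

lemma frame {n : ℕ} (G A : Euc n →L[ℝ] Euc n →L[ℝ] ℝ) (hG : ∀ a b, G a b = G b a)
    (hA : ∀ a b, A a b = A b a) (hp : ∀ a, a ≠ 0 → 0 < G a a) :
    ∃ (v : Fin n → Euc n) (l : Fin n → ℝ),
      (∀ i j, G (v i) (v j) = if i = j then 1 else 0) ∧
      (∀ i j, A (v i) (v j) = if i = j then l i else 0) ∧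
      (∀ e, e = ∑ i, G e (v i) • v i) ∧
      (∀ B : Euc n →L[ℝ] Euc n →L[ℝ] ℝ, (bm B).det = (bm G).det →
        (Matrix.of fun i j => B (v i) (v j)).det = 1) := by
  obtain ⟨V, l, h1, h2⟩ := simul_diag (bm G) (bm A) (bm_pd hG hp) (bm_symm hA)
  have key : ∀ (B : Euc n →L[ℝ] Euc n →L[ℝ] ℝ) (i j : Fin n),
      B (WithLp.toLp 2 (fun k => V k i)) (WithLp.toLp 2 (fun k => V k j)) = (Vᵀ * bm B * V) i j := by
    intro B i j
    rw [bilin_eq, Matrix.mul_assoc, Matrix.mul_apply]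
    simp [dotProduct, mulVec, Matrix.mul_apply]
  refine ⟨fun i => WithLp.toLp 2 (fun k => V k i), l, ?_, ?_, ?_, ?_⟩
  · intro i j
    rw [key, h1, Matrix.one_apply]
  · intro i j
    rw [key, h2, Matrix.diagonal_apply]
  · intro e
    have h3 : V * (Vᵀ * bm G) = 1 := mul_eq_one_comm.1 h1
    have h4 : V *ᵥ (Vᵀ *ᵥ (bm G *ᵥ fun i => e i)) = fun i => e i := by
      rw [Matrix.mulVec_mulVec, Matrix.mulVec_mulVec, Matrix.mul_assoc, h3, Matrix.one_mulVec]
    have h5 : ∀ i, G e (WithLp.toLp 2 (fun k => V k i)) = (Vᵀ *ᵥ (bm G *ᵥ fun i => e i)) i := by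
      intro i
      rw [hG, bilin_eq]
      simp [dotProduct, mulVec]
    ext k
    have h6 := congrFun h4 k
    simp only [h5]
    rw [← h6]
    simp [mulVec, dotProduct, mul_comm]
  · intro B hB
    have : (Matrix.of fun i j => B (WithLp.toLp 2 (fun k => V k i)) (WithLp.toLp 2 (fun k => V k j)))
        = Vᵀ * bm B * V := by
      ext i j
      rw [of_apply, key]
    rw [this, det_mul, det_mul, det_transpose, hB]
    have := det_of_one h1
    linarith

lemma line_hasDerivAt {n : ℕ} {f : Euc n → ℝ} {x v : Euc n} {t : ℝ}
    (h : DifferentiableAt ℝ f (x + t • v)) :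
    HasDerivAt (fun s : ℝ => f (x + s • v)) (fderiv ℝ f (x + t • v) v) t := by
  have h2 : HasDerivAt (fun s : ℝ => x + s • v) v t := by
    have := ((hasDerivAt_id t).smul_const v).const_add x
    exact this.congr_deriv (by simp)
  exact h.hasFDerivAt.comp_hasDerivAt t h2

lemma line_mem {n : ℕ} {S : Set (Euc n)} (hS : IsOpen S) {x : Euc n} (hx : x ∈ S) (v : Euc n) :
    ∀ᶠ t in 𝓝 (0 : ℝ), x + t • v ∈ S := by
  have hc : Continuous (fun t : ℝ => x + t • v) := by fun_prop
  exact hc.continuousAt.eventually_mem (by simpa using hS.mem_nhds hx)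

lemma fderiv_apply_hasFDerivAt {n : ℕ} {f : Euc n → ℝ} {x : Euc n} (v : Euc n)
    (h : ContDiffAt ℝ 2 f x) (a : Euc n) :
    fderiv ℝ (fun y => fderiv ℝ f y v) x a = hs f x a v := by
  have h1 : DifferentiableAt ℝ (fderiv ℝ f) x :=
    (h.fderiv_right (m := 1) (by norm_num)).differentiableAt (by norm_num)
  have h2 := (h1.hasFDerivAt).clm_apply (hasFDerivAt_const v x)
  rw [h2.fderiv]
  simp [hs]

lemma line2 {n : ℕ} {S : Set (Euc n)} (hS : IsOpen S) {f : Euc n → ℝ} (hf : ContDiffOn ℝ 2 f S)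
    {x : Euc n} (hx : x ∈ S) (v : Euc n) :
    (∀ᶠ t in 𝓝 (0 : ℝ), HasDerivAt (fun s : ℝ => f (x + s • v)) (fderiv ℝ f (x + t • v) v) t) ∧
    HasDerivAt (fun s : ℝ => fderiv ℝ f (x + s • v) v) (hs f x v v) 0 := by
  constructor
  · filter_upwards [line_mem hS hx v] with t ht
    exact line_hasDerivAt ((hf.contDiffAt (hS.mem_nhds ht)).differentiableAt (by norm_num))
  · have hc := hf.contDiffAt (hS.mem_nhds hx)
    have h1 : DifferentiableAt ℝ (fderiv ℝ f) x :=
      (hc.fderiv_right (m := 1) (by norm_num)).differentiableAt (by norm_num)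
    have h2 : DifferentiableAt ℝ (fun y => fderiv ℝ f y v) (x + (0 : ℝ) • v) := by
      simpa using h1.clm_apply (differentiableAt_const v)
    have h3 := line_hasDerivAt h2
    refine h3.congr_deriv ?_
    simp only [zero_smul, add_zero]
    exact fderiv_apply_hasFDerivAt v hc v

lemma hs_symm {n : ℕ} {f : Euc n → ℝ} {x : Euc n} (h : ContDiffAt ℝ 2 f x) (a b : Euc n) :
    hs f x a b = hs f x b a :=
  (h.isSymmSndFDerivAt (by simp)) a b

lemma convex_grad {n : ℕ} {S : Set (Euc n)} {f : Euc n → ℝ} (hf : ConvexOn ℝ S f) {x y : Euc n}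
    (hx : x ∈ S) (hy : y ∈ S) (hd : DifferentiableAt ℝ f x) :
    f x + fderiv ℝ f x (y - x) ≤ f y := by
  have h1 : HasDerivAt (fun s : ℝ => f (x + s • (y - x))) (fderiv ℝ f x (y - x)) 0 := by
    have := line_hasDerivAt (f := f) (x := x) (v := y - x) (t := 0) (by simpa using hd)
    simpa using this
  have h2 := h1.tendsto_slope_zero_right
  have h3 : ∀ᶠ t in 𝓝[>] (0 : ℝ), t⁻¹ • (f (x + (0 + t) • (y - x)) - f (x + (0 : ℝ) • (y - x)))
      ≤ f y - f x := by
    have : Ioo (0 : ℝ) 1 ∈ 𝓝[>] (0 : ℝ) := Ioo_mem_nhdsGT one_pos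
    filter_upwards [this] with t ht
    have h4 := hf.2 hx hy (show (0 : ℝ) ≤ 1 - t by linarith [ht.2]) ht.1.le (by ring)
    have h5 : (1 - t) • x + t • y = x + (0 + t) • (y - x) := by
      rw [zero_add, smul_sub, sub_smul, one_smul]; abel
    rw [h5] at h4
    simp only [zero_smul, add_zero, smul_eq_mul] at h4 ⊢
    rw [inv_mul_le_iff₀ ht.1]
    nlinarith
  have := le_of_tendsto h2 h3
  linarith

lemma convex_hs {n : ℕ} {S : Set (Euc n)} (hS : IsOpen S) {f : Euc n → ℝ} (hf : ConvexOn ℝ S f)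
    (hc : ContDiffOn ℝ 2 f S) {x : Euc n} (hx : x ∈ S) (v : Euc n) : 0 ≤ hs f x v v := by
  obtain ⟨h1, h2⟩ := line2 hS hc hx v
  have hd := (hc.contDiffAt (hS.mem_nhds hx)).differentiableAt (by norm_num)
  have hmax : IsLocalMax (fun t : ℝ => fderiv ℝ f x v * t - f (x + t • v)) 0 := by
    filter_upwards [line_mem hS hx v] with t ht
    have := convex_grad hf hx ht hd
    simp only [add_sub_cancel_left, map_smul, smul_eq_mul, mul_zero, zero_smul, add_zero] at this ⊢
    linarith
  have := second_deriv_test (c := 0 - hs f x v v) hmax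
    (φ1 := fun t => fderiv ℝ f x v - fderiv ℝ f (x + t • v) v)
    (h1.mono fun t ht => by
      have h3 := ((hasDerivAt_id t).const_mul (fderiv ℝ f x v)).sub ht
      exact h3.congr_deriv (by simp))
    ((hasDerivAt_const _ _).sub h2)
  linarith [this.2]

end SPF

namespace SPF
open Matrix Filter Topology Set

variable {n : ℕ} {S : Set (Euc n)} {f g : Euc n → ℝ} {x : Euc n}

lemma smooth_at (hS : IsOpen S) (hf : ContDiffOn ℝ (⊤ : ℕ∞) f S) (hx : x ∈ S) :
    ContDiffAt ℝ (⊤ : ℕ∞) f x := hf.contDiffAt (hS.mem_nhds hx)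

lemma smooth_two (hf : ContDiffOn ℝ (⊤ : ℕ∞) f S) : ContDiffOn ℝ 2 f S :=
  contDiffOn_infty.1 hf 2

lemma smooth_diff (hS : IsOpen S) (hf : ContDiffOn ℝ (⊤ : ℕ∞) f S) (hx : x ∈ S) :
    DifferentiableAt ℝ f x := (smooth_at hS hf hx).differentiableAt (by simp)

lemma dd_smooth (hS : IsOpen S) (hf : ContDiffOn ℝ (⊤ : ℕ∞) f S) (v : Euc n) :
    ContDiffOn ℝ (⊤ : ℕ∞) (dd v f) S := by
  have h := hf.fderiv_of_isOpen (m := (⊤ : ℕ∞)) hS (by simp)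
  exact h.clm_apply contDiffOn_const

lemma dd_line (hS : IsOpen S) (hf : ContDiffOn ℝ (⊤ : ℕ∞) f S) (hx : x ∈ S) (v : Euc n) :
    ∀ᶠ t in 𝓝 (0 : ℝ), HasDerivAt (fun s : ℝ => f (x + s • v)) (dd v f (x + t • v)) t := by
  filter_upwards [line_mem hS hx v] with t ht
  exact line_hasDerivAt (smooth_diff hS hf ht)

lemma dd_line0 (hS : IsOpen S) (hf : ContDiffOn ℝ (⊤ : ℕ∞) f S) (hx : x ∈ S) (v : Euc n) :
    HasDerivAt (fun s : ℝ => f (x + s • v)) (dd v f x) 0 := by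
  simpa using (dd_line hS hf hx v).self_of_nhds

lemma dd_dd (hS : IsOpen S) (hf : ContDiffOn ℝ (⊤ : ℕ∞) f S) (hx : x ∈ S) (a b : Euc n) :
    dd a (dd b f) x = hs f x a b :=
  fderiv_apply_hasFDerivAt b ((smooth_two hf).contDiffAt (hS.mem_nhds hx)) a

lemma dd_comm (hS : IsOpen S) (hf : ContDiffOn ℝ (⊤ : ℕ∞) f S) (a b : Euc n) :
    EqOn (dd a (dd b f)) (dd b (dd a f)) S := by
  intro x hx
  rw [dd_dd hS hf hx, dd_dd hS hf hx, hs_symm ((smooth_two hf).contDiffAt (hS.mem_nhds hx))]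

lemma dd_congr (hS : IsOpen S) (h : EqOn f g S) (v : Euc n) : EqOn (dd v f) (dd v g) S := by
  intro x hx
  have : f =ᶠ[𝓝 x] g := by
    filter_upwards [hS.mem_nhds hx] with y hy using h hy
  simp only [dd]
  rw [this.fderiv_eq]

lemma dd_swap (hS : IsOpen S) (hf : ContDiffOn ℝ (⊤ : ℕ∞) f S) (a b : Euc n) :
    EqOn (dd a (dd b (dd b f))) (dd b (dd b (dd a f))) S :=
  (dd_comm hS (dd_smooth hS hf b) a b).trans (dd_congr hS (dd_comm hS hf a b) b)

/-- e e v v = v v e e -/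
lemma dd_swap2 (hS : IsOpen S) (hf : ContDiffOn ℝ (⊤ : ℕ∞) f S) (a b : Euc n) :
    EqOn (dd a (dd a (dd b (dd b f)))) (dd b (dd b (dd a (dd a f)))) S :=
  (dd_congr hS (dd_swap hS hf a b) a).trans (dd_swap hS (dd_smooth hS hf a) a b)

/-- e e e v v = v v e e e -/
lemma dd_swap3 (hS : IsOpen S) (hf : ContDiffOn ℝ (⊤ : ℕ∞) f S) (a b : Euc n) :
    EqOn (dd a (dd a (dd a (dd b (dd b f))))) (dd b (dd b (dd a (dd a (dd a f))))) S :=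
  (dd_congr hS (dd_swap2 hS hf a b) a).trans
    (dd_swap hS (dd_smooth hS (dd_smooth hS hf a) a) a b)

lemma dd_add (a b : Euc n) (f : Euc n → ℝ) (x : Euc n) : dd (a + b) f x = dd a f x + dd b f x := by
  simp [dd]

lemma dd_smul (c : ℝ) (a : Euc n) (f : Euc n → ℝ) (x : Euc n) : dd (c • a) f x = c * dd a f x := by
  simp [dd]

/-- third derivative as bilinear form in first two slots -/
def t3 (f : Euc n → ℝ) (x a b c : Euc n) : ℝ := dd a (dd b (dd c f)) x

lemma t3_comm1 (hS : IsOpen S) (hf : ContDiffOn ℝ (⊤ : ℕ∞) f S) (hx : x ∈ S) (a b c : Euc n) :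
    t3 f x a b c = t3 f x b a c := dd_comm hS (dd_smooth hS hf c) a b hx

lemma t3_comm2 (hS : IsOpen S) (hf : ContDiffOn ℝ (⊤ : ℕ∞) f S) (hx : x ∈ S) (a b c : Euc n) :
    t3 f x a b c = t3 f x a c b := dd_congr hS (dd_comm hS hf b c) a hx

lemma t3_add (a a' b c : Euc n) : t3 f x (a + a') b c = t3 f x a b c + t3 f x a' b c := dd_add _ _ _ _

lemma t3_smul (r : ℝ) (a b c : Euc n) : t3 f x (r • a) b c = r * t3 f x a b c := dd_smul _ _ _ _

lemma t3_hs (hS : IsOpen S) (hf : ContDiffOn ℝ (⊤ : ℕ∞) f S) (hx : x ∈ S) (a b c : Euc n) :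
    t3 f x a b c = hs (dd c f) x a b := dd_dd hS (dd_smooth hS hf c) hx a b

lemma t3_cube (hS : IsOpen S) (hf : ContDiffOn ℝ (⊤ : ℕ∞) f S) (hx : x ∈ S) (a v : Euc n) (τ : ℝ) :
    t3 f x (a + τ • v) (a + τ • v) (a + τ • v) = t3 f x a a a + 3 * τ * t3 f x a a v
      + 3 * τ ^ 2 * t3 f x a v v + τ ^ 3 * t3 f x v v v := by
  have c1 := t3_comm1 hS hf hx
  have c2 := t3_comm2 hS hf hx
  have h2 : ∀ a b b' c, t3 f x a (b + b') c = t3 f x a b c + t3 f x a b' c := by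
    intro a b b' c; rw [c1, t3_add, c1 b, c1 b']
  have h3 : ∀ a b c c', t3 f x a b (c + c') = t3 f x a b c + t3 f x a b c' := by
    intro a b c c'; rw [c2, h2, c2 a c, c2 a c']
  have s2 : ∀ (r : ℝ) a b c, t3 f x a (r • b) c = r * t3 f x a b c := by
    intro r a b c; rw [c1, t3_smul, c1 b]
  have s3 : ∀ (r : ℝ) a b c, t3 f x a b (r • c) = r * t3 f x a b c := by
    intro r a b c; rw [c2, s2, c2 a c]
  simp only [t3_add, h2, h3, t3_smul, s2, s3]
  rw [c1 v a a, c2 a v a, c1 v a v, c2 v v a, c1 v a v]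
  ring

lemma hs_sq (hS : IsOpen S) (hf : ContDiffOn ℝ (⊤ : ℕ∞) f S) (hx : x ∈ S) (a v : Euc n) (τ : ℝ) :
    hs f x (a + τ • v) (a + τ • v) = hs f x a a + 2 * τ * hs f x a v + τ ^ 2 * hs f x v v := by
  have := hs_symm ((smooth_two hf).contDiffAt (hS.mem_nhds hx)) v a
  simp [this]
  ring

/-- the det jets for a smooth solution -/
lemma jets (hS : IsOpen S) (hf : ContDiffOn ℝ (⊤ : ℕ∞) f S) (hx : x ∈ S)
    (hd : ∀ z ∈ S, (bm (hs f z)).det = 1) (e : Euc n) (v : Fin n → Euc n) (l : Fin n → ℝ)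
    (hv : ∀ i j, hs f x (v i) (v j) = if i = j then 1 else 0)
    (hl : ∀ i j, hs (dd e f) x (v i) (v j) = if i = j then l i else 0)
    (hB : ∀ B : Euc n →L[ℝ] Euc n →L[ℝ] ℝ, (bm B).det = (bm (hs f x)).det →
        (Matrix.of fun i j => B (v i) (v j)).det = 1) :
    ∑ i, l i = 0 ∧ ∑ i, dd (v i) (dd (v i) (dd e (dd e f))) x = ∑ i, l i ^ 2 ∧
    ∑ i, dd (v i) (dd (v i) (dd e (dd e (dd e f)))) x
      = 3 * ∑ i, l i * dd (v i) (dd (v i) (dd e (dd e f))) x - 2 * ∑ i, l i ^ 3 := by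
  have hsm : ∀ a b, ContDiffOn ℝ (⊤ : ℕ∞) (dd a (dd b f)) S := fun a b =>
    dd_smooth hS (dd_smooth hS hf b) a
  have J := det_jet (N := fun t => Matrix.of fun i j => dd (v i) (dd (v j) f) (x + t • e))
    (N1 := fun t => Matrix.of fun i j => dd e (dd (v i) (dd (v j) f)) (x + t • e))
    (N2 := fun t => Matrix.of fun i j => dd e (dd e (dd (v i) (dd (v j) f))) (x + t • e))
    (N3 := Matrix.of fun i j => dd e (dd e (dd e (dd (v i) (dd (v j) f)))) x)
    (by
      ext i j
      simp only [of_apply, zero_smul, add_zero]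
      rw [dd_dd hS hf hx, hv, Matrix.one_apply])
    (by
      rw [eventually_all]; intro i; rw [eventually_all]; intro j
      exact dd_line hS (hsm _ _) hx e)
    (by
      rw [eventually_all]; intro i; rw [eventually_all]; intro j
      exact dd_line hS (dd_smooth hS (hsm _ _) _) hx e)
    (by
      intro i j
      exact dd_line0 hS (dd_smooth hS (dd_smooth hS (hsm _ _) _) _) hx e)
    (by
      filter_upwards [line_mem hS hx e] with t ht
      rw [← hB (hs f (x + t • e)) (by rw [hd _ ht, hd _ hx])]
      congr 1
      ext i j
      simp only [of_apply]
      rw [dd_dd hS hf ht])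
  obtain ⟨J1, J2, J3⟩ := J
  have hN1 : (Matrix.of fun i j => dd e (dd (v i) (dd (v j) f)) (x + (0 : ℝ) • e)) = diagonal l := by
    ext i j
    simp only [of_apply, zero_smul, add_zero]
    have : dd e (dd (v i) (dd (v j) f)) x = dd (v i) (dd (v j) (dd e f)) x :=
      (t3_comm1 hS hf hx _ _ _).trans (t3_comm2 hS hf hx _ _ _)
    rw [this, dd_dd hS (dd_smooth hS hf e) hx, hl, Matrix.diagonal_apply]
  simp only [hN1] at J1 J2 J3
  have hN2 : ∀ i, dd e (dd e (dd (v i) (dd (v i) f))) (x + (0 : ℝ) • e)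
      = dd (v i) (dd (v i) (dd e (dd e f))) x := by
    intro i; simpa using dd_swap2 hS hf e (v i) hx
  have hN3 : ∀ i, dd e (dd e (dd e (dd (v i) (dd (v i) f)))) x
      = dd (v i) (dd (v i) (dd e (dd e (dd e f)))) x := by
    intro i; simpa using dd_swap3 hS hf e (v i) hx
  refine ⟨by simpa [Matrix.trace] using J1, ?_, ?_⟩
  · simp only [Matrix.trace, diag_apply, of_apply, hN2, diagonal_mul_diagonal, diagonal_apply_eq] at J2
    rw [J2]
    exact Finset.sum_congr rfl fun i _ => by ring
  · simp only [Matrix.trace, diag_apply, of_apply, hN2, hN3, diagonal_mul_diagonal, diagonal_mul,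
      diagonal_apply_eq] at J3
    rw [J3]
    congr 2
    exact Finset.sum_congr rfl fun i _ => by ring

end SPF

namespace SPF
open Matrix Filter Topology Set

variable {n : ℕ}

lemma fderiv_of_line {f : Euc n → ℝ} {y b : Euc n} {α β γ : ℝ} (hf : DifferentiableAt ℝ f y)
    (h : ∀ t : ℝ, f (y + t • b) = α + β * t + γ * t ^ 2) : fderiv ℝ f y b = β := by
  have h1 := line_hasDerivAt (f := f) (x := y) (v := b) (t := 0) (by simpa using hf)
  have h2 : HasDerivAt (fun t : ℝ => f (y + t • b)) β 0 := by
    simp only [h]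
    have := (((hasDerivAt_id (0 : ℝ)).const_mul β).const_add α).add
      (((hasDerivAt_id (0 : ℝ)).pow 2).const_mul γ)
    exact this.congr_deriv (by simp)
  simpa using h1.unique h2

/-- quadratic barrier -/
def bar (a A R D : ℝ) (ξ ν z : Euc n) (x : Euc n) : ℝ :=
  a * (‖x - ξ‖ ^ 2 - R) / 2 + A * (inner ℝ ν (z - x) * (inner ℝ ν (z - x) - D)) / 2

lemma bar_contDiff (a A R D : ℝ) (ξ ν z : Euc n) {k : WithTop ℕ∞} : ContDiff ℝ k (bar a A R D ξ ν z) := by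
  unfold bar
  have h1 : ContDiff ℝ k (fun x : Euc n => ‖x - ξ‖ ^ 2) := (contDiff_id.sub contDiff_const).norm_sq ℝ
  have h2 : ContDiff ℝ k (fun x : Euc n => (inner ℝ ν (z - x) : ℝ)) :=
    contDiff_const.inner ℝ (contDiff_const.sub contDiff_id)
  fun_prop

lemma norm_line (x v : Euc n) (t : ℝ) :
    ‖x + t • v‖ ^ 2 = ‖x‖ ^ 2 + 2 * inner ℝ x v * t + ‖v‖ ^ 2 * t ^ 2 := by
  rw [norm_add_sq_real, real_inner_smul_right, norm_smul, mul_pow, Real.norm_eq_abs, sq_abs]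
  ring

lemma bar_fderiv (a A R D : ℝ) (ξ ν z x v : Euc n) : fderiv ℝ (bar a A R D ξ ν z) x v =
    a * inner ℝ (x - ξ) v - A * inner ℝ ν v * (2 * inner ℝ ν (z - x) - D) / 2 := by
  refine fderiv_of_line (α := bar a A R D ξ ν z x)
    (γ := (a * ‖v‖ ^ 2 + A * (inner ℝ ν v) ^ 2) / 2)
    ((bar_contDiff a A R D ξ ν z (k := 1)).differentiable (by norm_num) x) fun t => ?_
  have h1 : x + t • v - ξ = (x - ξ) + t • v := by abel
  have h2 : (inner ℝ ν (z - (x + t • v)) : ℝ) = inner ℝ ν (z - x) - t * inner ℝ ν v := by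
    rw [← sub_sub, inner_sub_right, real_inner_smul_right]
  unfold bar
  rw [h1, h2, norm_line]
  ring

lemma bar_hs (a A R D : ℝ) (ξ ν z x v u : Euc n) : hs (bar a A R D ξ ν z) x u v =
    a * inner ℝ u v + A * inner ℝ ν u * inner ℝ ν v := by
  rw [← fderiv_apply_hasFDerivAt v (bar_contDiff a A R D ξ ν z).contDiffAt u]
  have hd : DifferentiableAt ℝ (fun y => fderiv ℝ (bar a A R D ξ ν z) y v) x := by
    have h2 : ContDiff ℝ 2 (bar a A R D ξ ν z) := bar_contDiff a A R D ξ ν z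
    have := (h2.fderiv_right (m := 1) (by norm_num)).differentiable (by norm_num)
    exact (this x).clm_apply (differentiableAt_const v)
  refine fderiv_of_line (α := fderiv ℝ (bar a A R D ξ ν z) x v) (γ := 0) hd fun t => ?_
  have h1 : x + t • u - ξ = (x - ξ) + t • u := by abel
  have h2 : (inner ℝ ν (z - (x + t • u)) : ℝ) = inner ℝ ν (z - x) - t * inner ℝ ν u := by
    rw [← sub_sub, inner_sub_right, real_inner_smul_right]
  rw [bar_fderiv, bar_fderiv, h1, h2, inner_add_left, real_inner_smul_left]
  ring

lemma inner_single (i j : Fin n) : (inner ℝ (EuclideanSpace.single i (1 : ℝ)) (EuclideanSpace.single j (1 : ℝ)) : ℝ)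
    = if i = j then 1 else 0 := by
  simp [EuclideanSpace.inner_single_left, Pi.single_apply]

lemma bar_det (hn : 0 < n) (a A R D : ℝ) (ha : a ≠ 0) (ξ ν z x : Euc n) (hν : ‖ν‖ = 1) :
    (bm (hs (bar a A R D ξ ν z) x)).det = a ^ (n - 1) * (a + A) := by
  rw [← det_rank_one hn ha (fun i => ν i) (by
    have : ‖ν‖ ^ 2 = 1 := by rw [hν]; norm_num
    rw [EuclideanSpace.real_norm_sq_eq] at this
    rw [← this]
    simp [dotProduct, sq])]
  congr 1
  ext i j
  rw [Matrix.add_apply, Matrix.smul_apply, Matrix.smul_apply, vecMulVec_apply, Matrix.one_apply, bm,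
    of_apply, bar_hs, inner_single, EuclideanSpace.inner_single_right,
    EuclideanSpace.inner_single_right]
  simp
  ring

lemma comparison (hn : 0 < n) {Ω : Set (Euc n)} (hΩ : IsOpen Ω) {ξ : Euc n} {R : ℝ}
    (hb : Ω ⊆ Metric.ball ξ R) {f h : Euc n → ℝ} (hf : ContDiffOn ℝ 2 f Ω) (hh : ContDiffOn ℝ 2 h Ω)
    (hfc : ContinuousOn f (closure Ω)) (hhc : ContinuousOn h (closure Ω))
    (hp : ∀ x ∈ Ω, ∀ a, 0 ≤ hs h x a a)
    (hd : ∀ x ∈ Ω, (bm (hs f x)).det ≤ (bm (hs h x)).det)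
    (hfr : ∀ x ∈ frontier Ω, h x ≤ f x) : ∀ x ∈ Ω, h x ≤ f x := by
  intro x hx
  by_contra hcon
  push Not at hcon
  have hcl : closure Ω ⊆ Metric.closedBall ξ R :=
    (closure_mono hb).trans Metric.closure_ball_subset_closedBall
  have hcomp : IsCompact (closure Ω) := (isCompact_closedBall ξ R).of_isClosed_subset isClosed_closure hcl
  set ε := (h x - f x) / (2 * (R ^ 2 + 1)) with hε
  have hε0 : 0 < ε := by apply div_pos <;> nlinarith [sq_nonneg R]
  set Φ : Euc n → ℝ := fun y => f y - h y - ε * (‖y - ξ‖ ^ 2 - R ^ 2) with hΦ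
  have hΦc : ContinuousOn Φ (closure Ω) := by
    apply (hfc.sub hhc).sub
    apply Continuous.continuousOn
    fun_prop
  obtain ⟨x0, hx0, hmin⟩ := hcomp.exists_isMinOn ⟨x, subset_closure hx⟩ hΦc
  have hq : ∀ y ∈ closure Ω, ‖y - ξ‖ ^ 2 ≤ R ^ 2 := by
    intro y hy
    have := hcl hy
    rw [mem_closedBall_iff_norm] at this
    exact pow_le_pow_left₀ (norm_nonneg _) this 2
  have hΦx : Φ x < 0 := by
    have : ε * (2 * (R ^ 2 + 1)) = h x - f x := by
      rw [hε]; field_simp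
    have h3 : 0 ≤ ε * ‖x - ξ‖ ^ 2 := by positivity
    simp only [hΦ]
    nlinarith
  have hΦ0 : Φ x0 < 0 := lt_of_le_of_lt (hmin (subset_closure hx)) hΦx
  have hx0Ω : x0 ∈ Ω := by
    by_contra hno
    have hfr0 : x0 ∈ frontier Ω := by
      rw [hΩ.frontier_eq]; exact ⟨hx0, hno⟩
    have h1 := hfr x0 hfr0
    have h2 := hq x0 hx0
    simp only [hΦ] at hΦ0
    nlinarith
  have hkey : ∀ v, hs h x0 v v + 2 * ε * ‖v‖ ^ 2 ≤ hs f x0 v v := by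
    intro v
    obtain ⟨f1, f2⟩ := line2 hΩ hf hx0Ω v
    obtain ⟨h1, h2⟩ := line2 hΩ hh hx0Ω v
    have hqd : ∀ t : ℝ, HasDerivAt (fun s : ℝ => ‖x0 + s • v - ξ‖ ^ 2 - R ^ 2)
        (2 * inner ℝ (x0 - ξ) v + 2 * ‖v‖ ^ 2 * t) t := by
      intro t
      have e : (fun s : ℝ => ‖x0 + s • v - ξ‖ ^ 2 - R ^ 2) = fun s : ℝ =>
          (‖x0 - ξ‖ ^ 2 - R ^ 2) + (2 * inner ℝ (x0 - ξ) v * s + ‖v‖ ^ 2 * s ^ 2) := by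
        funext s
        rw [show x0 + s • v - ξ = (x0 - ξ) + s • v by abel, norm_line]; ring
      rw [e]
      have := (((hasDerivAt_id t).const_mul (2 * inner ℝ (x0 - ξ) v)).add
        (((hasDerivAt_id t).pow 2).const_mul (‖v‖ ^ 2))).const_add (‖x0 - ξ‖ ^ 2 - R ^ 2)
      exact this.congr_deriv (by simp; ring)
    have hloc : IsLocalMax (fun t : ℝ => - Φ (x0 + t • v)) 0 := by
      filter_upwards [line_mem hΩ hx0Ω v] with t ht
      have := hmin (subset_closure ht)
      simpa using this
    have T := second_deriv_test hloc
      (φ1 := fun t => -(fderiv ℝ f (x0 + t • v) v - fderiv ℝ h (x0 + t • v) v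
        - ε * (2 * inner ℝ (x0 - ξ) v + 2 * ‖v‖ ^ 2 * t)))
      (c := -(hs f x0 v v - hs h x0 v v - ε * (2 * ‖v‖ ^ 2))) (by
        filter_upwards [f1, h1] with t a b
        exact ((a.sub b).sub ((hqd t).const_mul ε)).neg) (by
        have : HasDerivAt (fun t : ℝ => 2 * inner ℝ (x0 - ξ) v + 2 * ‖v‖ ^ 2 * t) (2 * ‖v‖ ^ 2) 0 := by
          have := ((hasDerivAt_id (0 : ℝ)).const_mul (2 * ‖v‖ ^ 2)).const_add (2 * inner ℝ (x0 - ξ) v)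
          exact this.congr_deriv (by simp)
        exact ((f2.sub h2).sub (this.const_mul ε)).neg)
    have := T.2
    linarith
  have hsf := hs_symm (hf.contDiffAt (hΩ.mem_nhds hx0Ω))
  have hsh := hs_symm (hh.contDiffAt (hΩ.mem_nhds hx0Ω))
  have hpsd : (bm (hs h x0)).PosSemidef := bm_psd hsh (hp x0 hx0Ω)
  have hpd : (bm (hs h x0) + (2 * ε) • 1).PosDef :=
    Matrix.PosDef.posSemidef_add hpsd (Matrix.PosDef.one.smul (by positivity))
  have hdiff : (bm (hs f x0) - (bm (hs h x0) + (2 * ε) • 1)).PosSemidef := by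
    refine .of_dotProduct_mulVec_nonneg ?_ fun y => ?_
    · exact (bm_symm hsf).sub ((bm_symm hsh).add (by
        unfold Matrix.IsHermitian; simp))
    · have := hkey (WithLp.toLp 2 y)
      rw [bilin_eq, bilin_eq, EuclideanSpace.real_norm_sq_eq] at this
      simp only [sub_mulVec, add_mulVec, dotProduct_sub, dotProduct_add, smul_mulVec, one_mulVec,
        dotProduct_smul, smul_eq_mul, star_trivial]
      have e : y ⬝ᵥ y = ∑ i, y i ^ 2 := by simp [dotProduct, sq]
      rw [e]
      linarith
  have h1 := det_mono hpd hdiff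
  have h2 := det_add_lt hn hpsd (ε := 2 * ε) (by positivity)
  have h3 := hd x0 hx0Ω
  linarith

end SPF

namespace SPF
open Matrix Filter Topology Set

/-- Convex smooth solution of `det D²w = 1` on a normalised convex domain. -/
structure Sol (n : ℕ) (S : Set (Euc n)) (ξ : Euc n) (w : Euc n → ℝ) : Prop where
  hn : 2 ≤ n
  op : IsOpen S
  cvx : Convex ℝ S
  bdd : S ⊆ Metric.ball ξ (n : ℝ)
  cw : ConvexOn ℝ S w
  sm : ContDiffOn ℝ (⊤ : ℕ∞) w S
  cont : ContinuousOn w (closure S)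
  det : ∀ z ∈ S, (bm (hs w z)).det = 1
  fr : ∀ z ∈ frontier S, w z = 0
  neg : ∀ z ∈ S, w z ≤ 0

namespace Sol
variable {n : ℕ} {S : Set (Euc n)} {ξ : Euc n} {w : Euc n → ℝ}

lemma exists_unit (hn : 2 ≤ n) : ∃ ν : Euc n, ‖ν‖ = 1 :=
  ⟨EuclideanSpace.single ⟨0, by omega⟩ 1, by simp⟩

lemma symm (s : Sol n S ξ w) {x : Euc n} (hx : x ∈ S) (a b : Euc n) : hs w x a b = hs w x b a :=
  hs_symm ((smooth_two s.sm).contDiffAt (s.op.mem_nhds hx)) a b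

lemma psd (s : Sol n S ξ w) {x : Euc n} (hx : x ∈ S) (a : Euc n) : 0 ≤ hs w x a a :=
  convex_hs s.op s.cw (smooth_two s.sm) hx a

lemma pos (s : Sol n S ξ w) {x : Euc n} (hx : x ∈ S) {a : Euc n} (ha : a ≠ 0) : 0 < hs w x a a := by
  refine pos_of_bm ?_ ha
  have h := bm_psd (s.symm hx) (s.psd hx)
  refine (h.posDef_iff_isUnit).2 ?_
  rw [Matrix.isUnit_iff_isUnit_det, s.det x hx]
  exact isUnit_one

lemma lower (s : Sol n S ξ w) {x : Euc n} (hx : x ∈ S) : -(n : ℝ) ^ 2 / 2 ≤ w x := by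
  have hn := s.hn
  obtain ⟨ν, hν⟩ := exists_unit hn
  have := comparison (by omega) s.op s.bdd (smooth_two s.sm)
    (h := bar 1 0 ((n : ℝ) ^ 2) 0 ξ ν 0) (bar_contDiff _ _ _ _ _ _ _).contDiffOn s.cont
    (bar_contDiff _ _ _ _ _ _ _ (k := 1)).continuous.continuousOn
    (fun x _ a => by rw [bar_hs]; simp) (fun x hx => by
      rw [s.det x hx, bar_det (by omega) _ _ _ _ one_ne_zero _ _ _ _ hν]; simp) (fun x hx => by
      rw [s.fr x hx]
      have hx' : x ∈ Metric.closedBall ξ (n : ℝ) :=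
        (closure_mono s.bdd).trans Metric.closure_ball_subset_closedBall (frontier_subset_closure hx)
      rw [mem_closedBall_iff_norm] at hx'
      have := pow_le_pow_left₀ (norm_nonneg _) hx' 2
      simp only [bar]
      linarith) x hx
  refine le_trans ?_ this
  simp only [bar]
  nlinarith [sq_nonneg ‖x - ξ‖]

lemma dist_bd (n : ℕ) (hn : 2 ≤ n) (ε : ℝ) (hε : 0 < ε) : ∃ d : ℝ, 0 < d ∧ d ≤ 1 ∧
    ∀ (S : Set (Euc n)) (ξ : Euc n) (w : Euc n → ℝ), Sol n S ξ w →
      ∀ y ∈ S, w y ≤ -ε → Metric.ball y d ⊆ S := by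
  have hn0 : (0 : ℝ) < n := by exact_mod_cast (by omega : 0 < n)
  set a : ℝ := ε / n ^ 2 with ha
  have ha0 : 0 < a := by positivity
  set A : ℝ := (a ^ (n - 1))⁻¹ with hA
  have hA0 : 0 < A := by positivity
  set D : ℝ := 2 * n + 1 with hD
  have hD0 : 0 < D := by positivity
  refine ⟨min 1 (ε / (A * D)), by positivity, min_le_left _ _, ?_⟩
  intro S ξ w s y hy hwy z hz
  by_contra hzS
  obtain ⟨F, hF⟩ := geometric_hahn_banach_open_point s.cvx s.op hzS
  set p := (InnerProductSpace.toDual ℝ (Euc n)).symm F with hp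
  have hFp : ∀ x, F x = inner ℝ p x := fun x => (InnerProductSpace.toDual_symm_apply).symm
  have hp0 : p ≠ 0 := by
    intro h
    have := hF y hy
    rw [hFp, hFp, h] at this
    simp at this
  have hpn : 0 < ‖p‖ := norm_pos_iff.2 hp0
  set ν := (‖p‖)⁻¹ • p with hν
  have hν1 : ‖ν‖ = 1 := by rw [hν, norm_smul, norm_inv, norm_norm, inv_mul_cancel₀ hpn.ne']
  have hzy : ‖z - y‖ < min 1 (ε / (A * D)) := by
    rwa [← mem_ball_iff_norm]
  have hle : ∀ x ∈ S, 0 ≤ (inner ℝ ν (z - x) : ℝ) ∧ (inner ℝ ν (z - x) : ℝ) ≤ D := by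
    intro x hx
    constructor
    · rw [hν, real_inner_smul_left, inner_sub_right, ← hFp, ← hFp]
      have := hF x hx
      have : 0 ≤ F z - F x := by linarith
      positivity
    · refine (real_inner_le_norm _ _).trans ?_
      rw [hν1, one_mul]
      have h1 := s.bdd hx
      have h2 := s.bdd hy
      rw [mem_ball_iff_norm] at h1 h2
      have h3 : ‖z - y‖ < 1 := hzy.trans_le (min_le_left _ _)
      have : z - x = (z - y) + (y - ξ) - (x - ξ) := by abel
      rw [this]
      have := norm_sub_le ((z - y) + (y - ξ)) (x - ξ)
      have := norm_add_le (z - y) (y - ξ)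
      linarith
  have hle' : ∀ x ∈ closure S, 0 ≤ (inner ℝ ν (z - x) : ℝ) ∧ (inner ℝ ν (z - x) : ℝ) ≤ D := by
    have hcl : IsClosed {x : Euc n | 0 ≤ (inner ℝ ν (z - x) : ℝ) ∧ (inner ℝ ν (z - x) : ℝ) ≤ D} := by
      apply IsClosed.and
      · exact isClosed_le (by fun_prop) (by fun_prop)
      · exact isClosed_le (by fun_prop) (by fun_prop)
    exact closure_minimal hle hcl
  have := comparison (by omega) s.op s.bdd (smooth_two s.sm)
    (h := bar a A ((n : ℝ) ^ 2) D ξ ν z) (bar_contDiff _ _ _ _ _ _ _).contDiffOn s.cont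
    (bar_contDiff _ _ _ _ _ _ _ (k := 1)).continuous.continuousOn
    (fun x _ b => by
      rw [bar_hs]
      have := real_inner_self_nonneg (F := Euc n) (x := b)
      have := mul_self_nonneg (inner ℝ ν b : ℝ)
      rw [mul_assoc]
      positivity) (fun x hx => by
      rw [s.det x hx, bar_det (by omega) _ _ _ _ ha0.ne' _ _ _ _ hν1, mul_add]
      have : a ^ (n - 1) * A = 1 := by rw [hA]; field_simp
      rw [this]
      have : 0 < a ^ (n - 1) * a := by positivity
      linarith) (fun x hx => by
      rw [s.fr x hx]
      have hx' : x ∈ Metric.closedBall ξ (n : ℝ) :=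
        (closure_mono s.bdd).trans Metric.closure_ball_subset_closedBall (frontier_subset_closure hx)
      rw [mem_closedBall_iff_norm] at hx'
      have h1 := pow_le_pow_left₀ (norm_nonneg _) hx' 2
      obtain ⟨h2, h3⟩ := hle' x (frontier_subset_closure hx)
      simp only [bar]
      have e1 : a * (‖x - ξ‖ ^ 2 - n ^ 2) ≤ 0 := mul_nonpos_of_nonneg_of_nonpos ha0.le (by linarith)
      have e2 : A * (inner ℝ ν (z - x) * (inner ℝ ν (z - x) - D)) ≤ 0 :=
        mul_nonpos_of_nonneg_of_nonpos hA0.le (mul_nonpos_of_nonneg_of_nonpos h2 (by linarith))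
      linarith) y hy
  obtain ⟨h2, h3⟩ := hle y hy
  have h4 : (inner ℝ ν (z - y) : ℝ) ≤ ‖z - y‖ := by
    refine (real_inner_le_norm _ _).trans ?_
    rw [hν1, one_mul]
  have h5 : (inner ℝ ν (z - y) : ℝ) < ε / (A * D) := h4.trans_lt (hzy.trans_le (min_le_right _ _))
  have h6 : A * D * inner ℝ ν (z - y) < ε := by
    rw [lt_div_iff₀ (by positivity)] at h5
    linarith
  have h7 : a * (n : ℝ) ^ 2 = ε := by rw [ha]; field_simp
  have h8 : 0 ≤ A * (inner ℝ ν (z - y)) ^ 2 := by positivity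
  have h9 : 0 ≤ a * ‖y - ξ‖ ^ 2 := by positivity
  simp only [bar] at this
  nlinarith

lemma grad_bd (s : Sol n S ξ w) {y : Euc n} (hy : y ∈ S) {d : ℝ} (hd : 0 < d)
    (hb : Metric.ball y d ⊆ S) (e : Euc n) : |dd e w y| ≤ (n : ℝ) ^ 2 / d * ‖e‖ := by
  have key : ∀ e : Euc n, dd e w y ≤ (n : ℝ) ^ 2 / d * ‖e‖ := by
    intro e
    rcases eq_or_ne e 0 with rfl | he
    · simp [dd]
    have hen : 0 < ‖e‖ := norm_pos_iff.2 he
    set r := d / 2 / ‖e‖ with hr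
    have hr0 : 0 < r := by positivity
    have hm : y + r • e ∈ S := by
      apply hb
      rw [mem_ball_iff_norm, add_sub_cancel_left, norm_smul, Real.norm_eq_abs, abs_of_pos hr0, hr,
        div_mul_cancel₀ _ hen.ne']
      linarith
    have h1 := convex_grad s.cw hy hm (smooth_diff s.op s.sm hy)
    rw [add_sub_cancel_left, map_smul, smul_eq_mul] at h1
    have h2 := s.neg _ hm
    have h3 := s.lower hy
    have h4 : r * dd e w y ≤ (n : ℝ) ^ 2 / 2 := by unfold dd; linarith
    have h5 : r * ((n : ℝ) ^ 2 / d * ‖e‖) = (n : ℝ) ^ 2 / 2 := by rw [hr]; field_simp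
    exact le_of_mul_le_mul_left (by linarith) hr0
  rw [abs_le]
  constructor
  · have := key (-e)
    rw [norm_neg] at this
    have e2 : dd (-e) w y = - dd e w y := by simp [dd]
    linarith
  · exact key e

lemma sub_closed (s : Sol n S ξ w) {ε : ℝ} (hε : 0 < ε) : IsCompact {x | x ∈ S ∧ w x ≤ -ε} := by
  have hcl : closure S ⊆ Metric.closedBall ξ n :=
    (closure_mono s.bdd).trans Metric.closure_ball_subset_closedBall
  have hcomp : IsCompact (closure S) :=
    (isCompact_closedBall ξ n).of_isClosed_subset isClosed_closure hcl
  have he : {x | x ∈ S ∧ w x ≤ -ε} = closure S ∩ w ⁻¹' (Iic (-ε)) := by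
    ext x
    constructor
    · rintro ⟨h1, h2⟩; exact ⟨subset_closure h1, h2⟩
    · rintro ⟨h1, h2⟩
      refine ⟨?_, h2⟩
      by_contra hno
      have := s.fr x (by rw [s.op.frontier_eq]; exact ⟨h1, hno⟩)
      simp only [mem_preimage, mem_Iic] at h2
      linarith
  rw [he]
  exact hcomp.of_isClosed_subset (s.cont.preimage_isClosed_of_isClosed isClosed_closure isClosed_Iic)
    inter_subset_left

end Sol
end SPF

namespace SPF
open Matrix Filter Topology Set

lemma sq_ineq {n : ℕ} (l ε : Fin n → ℝ) (h1 : ∑ i, ε i ^ 2 = 1) :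
    0 ≤ ∑ i, l i ^ 2 - 2 * ∑ i, l i ^ 2 * ε i ^ 2 + (∑ i, l i * ε i ^ 2) ^ 2 := by
  set T := ∑ i, l i * ε i ^ 2 with hT
  set Q := ∑ i, l i ^ 2 * ε i ^ 2 with hQ
  have row : ∀ i, 0 ≤ l i ^ 2 - 3 * (l i ^ 2 * ε i ^ 2) + 2 * T * (l i * ε i ^ 2)
      + (Q - T ^ 2) * ε i ^ 2 := by
    intro i
    have h := Finset.sum_nonneg (s := Finset.univ) (fun j _ =>
      sq_nonneg ((if i = j then l i else 0) - ε i * ε j * (l i + l j - T)))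
    have e : ∀ j, ((if i = j then l i else 0) - ε i * ε j * (l i + l j - T)) ^ 2 =
        (if i = j then l i ^ 2 - 2 * l i * ε i ^ 2 * (2 * l i - T) else 0)
        + (ε i ^ 2 * (l i - T) ^ 2 * ε j ^ 2 + 2 * ε i ^ 2 * (l i - T) * (l j * ε j ^ 2)
        + ε i ^ 2 * (l j ^ 2 * ε j ^ 2)) := by
      intro j
      split_ifs with hij
      · subst hij; ring
      · ring
    simp only [e, Finset.sum_add_distrib, ← Finset.mul_sum, h1, ← hT, ← hQ, Finset.sum_ite_eq,
      Finset.mem_univ, if_true] at h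
    linarith
  have h := Finset.sum_nonneg (s := Finset.univ) (fun i _ => row i)
  simp only [Finset.sum_add_distrib, Finset.sum_sub_distrib, ← Finset.mul_sum, h1, ← hT, ← hQ] at h
  linarith

lemma log_test {s s1 m m1 W W1 : ℝ → ℝ} {s2 m2 W2 : ℝ} (hs0 : 0 < s 0) (hm0 : 0 < m 0)
    (hs : ∀ᶠ t in 𝓝 (0 : ℝ), HasDerivAt s (s1 t) t) (hs1 : HasDerivAt s1 s2 0)
    (hm : ∀ᶠ t in 𝓝 (0 : ℝ), HasDerivAt m (m1 t) t) (hm1 : HasDerivAt m1 m2 0)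
    (hW : ∀ᶠ t in 𝓝 (0 : ℝ), HasDerivAt W (W1 t) t) (hW1 : HasDerivAt W1 W2 0)
    (hmax : ∀ᶠ t in 𝓝 (0 : ℝ), s t * Real.exp (W t) * m t ≤ s 0 * Real.exp (W 0) * m 0) :
    s1 0 / s 0 + m1 0 / m 0 + W1 0 = 0 ∧
    s2 / s 0 - (s1 0 / s 0) ^ 2 + (m2 / m 0 - (m1 0 / m 0) ^ 2) + W2 ≤ 0 := by
  have ps : ∀ᶠ t in 𝓝 (0 : ℝ), 0 < s t :=
    (hs.self_of_nhds.continuousAt).eventually (lt_mem_nhds hs0)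
  have pm : ∀ᶠ t in 𝓝 (0 : ℝ), 0 < m t :=
    (hm.self_of_nhds.continuousAt).eventually (lt_mem_nhds hm0)
  have hloc : IsLocalMax (fun t => Real.log (s t) + Real.log (m t) + W t) 0 := by
    filter_upwards [ps, pm, hmax] with t h1 h2 h3
    have e : ∀ t, 0 < s t → 0 < m t → Real.log (s t * Real.exp (W t) * m t)
        = Real.log (s t) + Real.log (m t) + W t := by
      intro t h1 h2
      rw [Real.log_mul (by positivity) h2.ne', Real.log_mul h1.ne' (Real.exp_pos _).ne', Real.log_exp]
      ring
    have := Real.log_le_log (by positivity) h3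
    rw [e t h1 h2, e 0 hs0 hm0] at this
    exact this
  have T := second_deriv_test hloc (φ1 := fun t => s1 t / s t + m1 t / m t + W1 t)
    (c := (s2 * s 0 - s1 0 * s1 0) / s 0 ^ 2 + (m2 * m 0 - m1 0 * m1 0) / m 0 ^ 2 + W2)
    (by
      filter_upwards [ps, pm, hs, hm, hW] with t h1 h2 a b c
      exact ((a.log h1.ne').add (b.log h2.ne')).add c)
    (((hs1.div hs.self_of_nhds hs0.ne').add (hm1.div hm.self_of_nhds hm0.ne')).add hW1)
  refine ⟨T.1, ?_⟩
  have h2 := T.2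
  have e1 : s2 / s 0 - (s1 0 / s 0) ^ 2 = (s2 * s 0 - s1 0 * s1 0) / s 0 ^ 2 := by
    field_simp
  have e2 : m2 / m 0 - (m1 0 / m 0) ^ 2 = (m2 * m 0 - m1 0 * m1 0) / m 0 ^ 2 := by
    field_simp
  rw [e1, e2]
  exact h2

namespace Sol
variable {n : ℕ} {S : Set (Euc n)} {ξ : Euc n} {w : Euc n → ℝ}

lemma pogorelov (s : Sol n S ξ w) {ε K : ℝ} (hε : 0 < ε) (hK : 0 ≤ K) (e : Euc n) (he : e ≠ 0)
    (hg : ∀ y ∈ S, w y ≤ -ε → |dd e w y| ≤ K) {x : Euc n} (hx : x ∈ S) (hwx : w x ≤ -ε) :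
    (-ε - w x) * Real.exp ((dd e w x) ^ 2 / 2) * hs w x e e ≤ (n + K) * Real.exp (K ^ 2 / 2) := by
  have hop := s.op
  have hsm := s.sm
  have sm1 := dd_smooth hop hsm e
  have sm2 := dd_smooth hop sm1 e
  set ψ : Euc n → ℝ := fun y => (-ε - w y) * Real.exp ((dd e w y) ^ 2 / 2) * dd e (dd e w) y with hψ
  have hψc : ContinuousOn ψ S := by
    have c0 := hsm.continuousOn
    have c1 := sm1.continuousOn
    have c2 := sm2.continuousOn
    fun_prop
  obtain ⟨x0, ⟨hx0, hwx0⟩, hmax⟩ := (s.sub_closed hε).exists_isMaxOn ⟨x, hx, hwx⟩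
    (hψc.mono fun y hy => hy.1)
  have hxx : (-ε - w x) * Real.exp ((dd e w x) ^ 2 / 2) * hs w x e e ≤ ψ x0 := by
    have := hmax (show x ∈ {x | x ∈ S ∧ w x ≤ -ε} from ⟨hx, hwx⟩)
    simp only [hψ, mem_setOf_eq] at this
    rw [dd_dd hop hsm hx] at this
    exact this
  refine hxx.trans ?_
  rcases le_or_gt (ψ x0) 0 with h0 | h0
  · exact h0.trans (by positivity)
  set m := dd e (dd e w) x0 with hm
  have hmG : m = hs w x0 e e := dd_dd hop hsm hx0 e e
  have hm0 : 0 < m := by rw [hmG]; exact s.pos hx0 he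
  set σ := -ε - w x0 with hσ
  have hσ0 : 0 < σ := by
    have : 0 ≤ σ := by simp only [hσ]; linarith
    rcases this.eq_or_lt with h | h
    · exfalso
      simp only [hψ] at h0
      rw [← hσ, ← h] at h0
      simp at h0
    · exact h
  set q := dd e w x0 with hq
  have hqK : |q| ≤ K := hg x0 hx0 hwx0
  obtain ⟨v, l, hv, hl, hfr, hB⟩ := frame (hs w x0) (hs (dd e w) x0) (s.symm hx0)
    (fun a b => hs_symm ((smooth_two sm1).contDiffAt (hop.mem_nhds hx0)) a b)
    (fun a ha => s.pos hx0 ha)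
  obtain ⟨j1, j2, -⟩ := jets hop hsm hx0 s.det e v l hv hl hB
  set E : Fin n → ℝ := fun i => hs w x0 e (v i) with hE
  have hev : ∀ F : Euc n →L[ℝ] ℝ, F e = ∑ i, E i * F (v i) := by
    intro F
    conv_lhs => rw [hfr e]
    simp [hE]
  have hEm : ∑ i, E i ^ 2 = m := by
    have := hev (hs w x0 e)
    rw [← hmG] at this
    rw [this]
    exact Finset.sum_congr rfl fun i _ => by simp only [hE]; ring
  -- derivative identities
  have d1 : ∀ i, dd (v i) (dd e w) x0 = E i := by
    intro i
    rw [dd_dd hop hsm hx0, s.symm hx0]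
  have d2 : ∀ i, dd (v i) (dd e (dd e w)) x0 = l i * E i := by
    intro i
    rw [dd_dd hop sm1 hx0, hev (hs (dd e w) x0 (v i))]
    simp only [hl]
    simp [mul_comm]
  have d3 : ∀ i, dd (v i) (dd (v i) (dd e w)) x0 = l i := by
    intro i
    rw [dd_dd hop sm1 hx0, hl]; simp
  have d4 : ∀ i, dd (v i) (dd (v i) w) x0 = 1 := by
    intro i
    rw [dd_dd hop hsm hx0, hv]; simp
  have d5 : q = ∑ i, E i * dd (v i) w x0 := hev (fderiv ℝ w x0)
  have hcont : ContinuousAt w x0 := hsm.continuousOn.continuousAt (hop.mem_nhds hx0)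
  -- test
  have test : ∀ i, -dd (v i) w x0 / σ + l i * E i / m + q * E i = 0 ∧
      -1 / σ - (-dd (v i) w x0 / σ) ^ 2 + (dd (v i) (dd (v i) (dd e (dd e w))) x0 / m
        - (l i * E i / m) ^ 2) + (E i ^ 2 + q * l i) ≤ 0 := by
    intro i
    have T := log_test (s := fun t => -ε - w (x0 + t • v i))
      (s1 := fun t => - dd (v i) w (x0 + t • v i)) (s2 := - dd (v i) (dd (v i) w) x0)
      (m := fun t => dd e (dd e w) (x0 + t • v i))
      (m1 := fun t => dd (v i) (dd e (dd e w)) (x0 + t • v i))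
      (m2 := dd (v i) (dd (v i) (dd e (dd e w))) x0)
      (W := fun t => (dd e w (x0 + t • v i)) ^ 2 / 2)
      (W1 := fun t => dd e w (x0 + t • v i) * dd (v i) (dd e w) (x0 + t • v i))
      (W2 := dd (v i) (dd e w) x0 * dd (v i) (dd e w) x0
        + dd e w x0 * dd (v i) (dd (v i) (dd e w)) x0)
      (by simp only [zero_smul, add_zero]; exact hσ0) (by simpa using hm0)
      (by
        filter_upwards [dd_line hop hsm hx0 (v i)] with t ht
        exact ht.const_sub (-ε))
      ((dd_line0 hop (dd_smooth hop hsm (v i)) hx0 (v i)).neg)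
      (dd_line hop sm2 hx0 (v i)) (dd_line0 hop (dd_smooth hop sm2 (v i)) hx0 (v i))
      (by
        filter_upwards [dd_line hop sm1 hx0 (v i)] with t ht
        exact ((ht.pow 2).div_const 2).congr_deriv (by push_cast; ring))
      (((dd_line0 hop sm1 hx0 (v i)).mul
        (dd_line0 hop (dd_smooth hop sm1 (v i)) hx0 (v i))).congr_deriv (by simp))
      (by
        have hc : Continuous (fun t : ℝ => x0 + t • v i) := by fun_prop
        have hw : ∀ᶠ t in 𝓝 (0 : ℝ), w (x0 + t • v i) < -ε := by
          have : ContinuousAt (fun t : ℝ => w (x0 + t • v i)) 0 := by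
            apply ContinuousAt.comp
            · simpa using hcont
            · exact hc.continuousAt
          refine this.eventually (gt_mem_nhds ?_)
          simp only [zero_smul, add_zero]
          linarith
        filter_upwards [line_mem hop hx0 (v i), hw] with t ht1 ht2
        have := hmax (show x0 + t • v i ∈ {x | x ∈ S ∧ w x ≤ -ε} from ⟨ht1, ht2.le⟩)
        simpa [hψ] using this)
    simp only [zero_smul, add_zero, d1, d2, d3, d4, ← hσ, ← hq, ← hm] at T
    refine ⟨T.1, ?_⟩
    have := T.2
    linarith
  -- sums
  have hp : ∀ i, dd (v i) w x0 / σ = l i * E i / m + q * E i := by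
    intro i
    have := (test i).1
    rw [neg_div] at this
    linarith
  set θ : Fin n → ℝ := fun i => E i / √m with hθ
  have hθ2 : ∀ i, θ i ^ 2 = E i ^ 2 / m := by
    intro i; simp only [hθ, div_pow, Real.sq_sqrt hm0.le]
  have hθ1 : ∑ i, θ i ^ 2 = 1 := by
    simp only [hθ2, ← Finset.sum_div, hEm, div_self hm0.ne']
  have hS := sq_ineq l θ hθ1
  set T := ∑ i, l i * θ i ^ 2 with hT
  set Q := ∑ i, l i ^ 2 * θ i ^ 2 with hQ
  have hqT : q / σ = T + q * m := by
    rw [d5, Finset.sum_div, ← d5]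
    have : ∀ i, E i * dd (v i) w x0 / σ = l i * θ i ^ 2 + q * E i ^ 2 := by
      intro i
      rw [mul_div_assoc, hp, hθ2]; ring
    simp only [this, Finset.sum_add_distrib, ← Finset.mul_sum, hEm, ← hT]
  have hrow : ∀ i, -1 / σ - (2 * (l i ^ 2 * θ i ^ 2) / m + 2 * q * (l i * θ i ^ 2) + q ^ 2 * E i ^ 2)
      + dd (v i) (dd (v i) (dd e (dd e w))) x0 / m + (E i ^ 2 + q * l i) ≤ 0 := by
    intro i
    have h := (test i).2
    rw [neg_div σ (dd (v i) w x0), neg_sq, hp] at h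
    have e1 : (l i * E i / m + q * E i) ^ 2 + (l i * E i / m) ^ 2
        = 2 * (l i ^ 2 * θ i ^ 2) / m + 2 * q * (l i * θ i ^ 2) + q ^ 2 * E i ^ 2 := by
      rw [hθ2]; field_simp; ring
    linarith
  have hsum := Finset.sum_nonpos (s := Finset.univ) (fun i _ => hrow i)
  simp only [Finset.sum_add_distrib, Finset.sum_sub_distrib, ← Finset.mul_sum, ← Finset.sum_div, hEm,
    ← hT, ← hQ, j1, j2, Finset.sum_const, Finset.card_univ, Fintype.card_fin, nsmul_eq_mul] at hsum
  have hfin : (m * σ) ^ 2 ≤ n * (m * σ) + q ^ 2 := by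
    have h1 : (-(T ^ 2) / m) ≤ (∑ i, l i ^ 2) / m - 2 * Q / m := by
      rw [← sub_div]; gcongr; linarith
    have h2 : (q / σ) ^ 2 / m = T ^ 2 / m + 2 * q * T + q ^ 2 * m := by
      rw [hqT]; field_simp; ring
    have h3 : m ≤ n / σ + (q / σ) ^ 2 / m := by
      rw [h2]
      have e3 : (n : ℝ) * -1 / σ = - (n / σ) := by ring
      have e4 : -(T ^ 2) / m = -(T ^ 2 / m) := by ring
      linarith
    have h4 := mul_le_mul_of_nonneg_right h3 (show 0 ≤ m * σ ^ 2 by positivity)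
    have h5 : (n / σ + (q / σ) ^ 2 / m) * (m * σ ^ 2) = n * (m * σ) + q ^ 2 := by field_simp
    rw [h5] at h4
    linarith
  have hms : m * σ ≤ n + K := by
    by_contra hc
    push Not at hc
    have hq2 : q ^ 2 ≤ K ^ 2 := by rw [← sq_abs]; exact pow_le_pow_left₀ (abs_nonneg _) hqK 2
    have hn0 : (0 : ℝ) ≤ n := by positivity
    nlinarith
  have hq2 : q ^ 2 ≤ K ^ 2 := by rw [← sq_abs]; exact pow_le_pow_left₀ (abs_nonneg _) hqK 2
  calc ψ x0 = (m * σ) * Real.exp (q ^ 2 / 2) := by simp only [hψ, ← hm, ← hσ, ← hq]; ring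
    _ ≤ (n + K) * Real.exp (K ^ 2 / 2) := by gcongr

end Sol
end SPF

namespace SPF
open Matrix Filter Topology Set

lemma cubic_jet {F0 F1 F2 F3 G0 G1 G2 G3 : ℝ → ℝ} {H0 H1 H2 H3 : ℝ} (a1 a2 a3 : ℝ)
    (f0 : ∀ᶠ t in 𝓝 (0 : ℝ), HasDerivAt F0 (G0 t) t) (f1 : ∀ᶠ t in 𝓝 (0 : ℝ), HasDerivAt F1 (G1 t) t)
    (f2 : ∀ᶠ t in 𝓝 (0 : ℝ), HasDerivAt F2 (G2 t) t) (f3 : ∀ᶠ t in 𝓝 (0 : ℝ), HasDerivAt F3 (G3 t) t)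
    (g0 : HasDerivAt G0 H0 0) (g1 : HasDerivAt G1 H1 0) (g2 : HasDerivAt G2 H2 0)
    (g3 : HasDerivAt G3 H3 0) :
    ∃ P1 : ℝ → ℝ, P1 0 = G0 0 + a1 * F1 0 ∧
      (∀ᶠ t in 𝓝 (0 : ℝ), HasDerivAt
        (fun t => F0 t + a1 * t * F1 t + a2 * t ^ 2 * F2 t + a3 * t ^ 3 * F3 t) (P1 t) t) ∧
      HasDerivAt P1 (H0 + 2 * a1 * G1 0 + 2 * a2 * F2 0) 0 := by
  refine ⟨fun t => G0 t + (a1 * F1 t + a1 * t * G1 t) + (2 * a2 * t * F2 t + a2 * t ^ 2 * G2 t)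
    + (3 * a3 * t ^ 2 * F3 t + a3 * t ^ 3 * G3 t), by simp, ?_, ?_⟩
  · filter_upwards [f0, f1, f2, f3] with t h0 h1 h2 h3
    have e1 := (hasDerivAt_id t).const_mul a1
    have e2 := (hasDerivAt_pow 2 t).const_mul a2
    have e3 := (hasDerivAt_pow 3 t).const_mul a3
    exact (((h0.add (e1.mul h1)).add (e2.mul h2)).add (e3.mul h3)).congr_deriv (by simp; ring)
  · have h1 := f1.self_of_nhds
    have h2 := f2.self_of_nhds
    have h3 := f3.self_of_nhds
    have e1 := (hasDerivAt_id (0 : ℝ)).const_mul a1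
    have e1' := (hasDerivAt_id (0 : ℝ)).const_mul (2 * a2)
    have e2 := (hasDerivAt_pow 2 (0 : ℝ)).const_mul a2
    have e2' := (hasDerivAt_pow 2 (0 : ℝ)).const_mul (3 * a3)
    have e3 := (hasDerivAt_pow 3 (0 : ℝ)).const_mul a3
    exact (((g0.add ((h1.const_mul a1).add (e1.mul g1))).add ((e1'.mul h2).add (e2.mul g2))).add
      ((e2'.mul h3).add (e3.mul g3))).congr_deriv (by simp; ring)

lemma exp_sqrt {Q : ℝ} (hQ : 0 < Q) : Real.exp (-(3 / 2) * Real.log Q) * (Q * √Q) = 1 := by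
  have h : √Q = Real.exp (Real.log Q / 2) := by
    rw [Real.exp_half, Real.exp_log hQ]
  have h2 : Q * √Q = Real.exp (Real.log Q + Real.log Q / 2) := by
    rw [Real.exp_add, Real.exp_log hQ, h]
  rw [h2, ← Real.exp_add, ← Real.exp_zero]
  congr 1
  ring

variable {n : ℕ} {S : Set (Euc n)} {ξ : Euc n} {w f : Euc n → ℝ}

lemma hs_contDiffOn (hS : IsOpen S) (hf : ContDiffOn ℝ (⊤ : ℕ∞) f S) :
    ContDiffOn ℝ (⊤ : ℕ∞) (hs f) S := by
  have h := hf.fderiv_of_isOpen (m := (⊤ : ℕ∞)) hS (by simp)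
  exact h.fderiv_of_isOpen (m := (⊤ : ℕ∞)) hS (by simp)

lemma t3_eq (hS : IsOpen S) (hf : ContDiffOn ℝ (⊤ : ℕ∞) f S) {x : Euc n} (hx : x ∈ S)
    (a b c : Euc n) : t3 f x a b c = fderiv ℝ (hs f) x a b c := by
  have h1 : EqOn (dd b (dd c f)) (fun y => hs f y b c) S := fun y hy => dd_dd hS hf hy b c
  have h2 := dd_congr hS h1 a hx
  unfold t3
  rw [h2]
  unfold dd
  have h3 : DifferentiableAt ℝ (hs f) x :=
    ((hs_contDiffOn hS hf).contDiffAt (hS.mem_nhds hx)).differentiableAt (by simp)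
  have h4 := (h3.hasFDerivAt.clm_apply (hasFDerivAt_const b x)).clm_apply (hasFDerivAt_const c x)
  rw [h4.fderiv]
  simp

lemma t3_hom (hS : IsOpen S) (hf : ContDiffOn ℝ (⊤ : ℕ∞) f S) {x : Euc n} (hx : x ∈ S)
    (r : ℝ) (e : Euc n) : t3 f x (r • e) (r • e) (r • e) = r ^ 3 * t3 f x e e e := by
  rw [t3_eq hS hf hx, t3_eq hS hf hx]
  simp
  ring

lemma hs_hom {x : Euc n} (r : ℝ) (e : Euc n) : hs f x (r • e) (r • e) = r ^ 2 * hs f x e e := by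
  simp
  ring

namespace Sol

set_option maxHeartbeats 2000000 in
set_option synthInstance.maxHeartbeats 400000 in
set_option maxSynthPendingDepth 6 in
lemma calabi (s : Sol n S ξ w) {ε K c : ℝ} (hε : 0 < ε) (hK : 0 ≤ K) (hc : 0 < c)
    (hg : ∀ y ∈ S, w y ≤ -ε → ∀ e, |dd e w y| ≤ K * ‖e‖)
    (hlow : ∀ y ∈ S, w y ≤ -ε → ∀ e, c * ‖e‖ ^ 2 ≤ hs w y e e)
    {x : Euc n} (hx : x ∈ S) (hwx : w x ≤ -ε) (e : Euc n) :
    (-ε - w x) * t3 w x e e e ≤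
      √(2 * n ^ 3 + 8 * K ^ 2 / c) * (hs w x e e * √(hs w x e e)) := by
  have hop := s.op
  have hsm := s.sm
  set R0 := √(2 * (n : ℝ) ^ 3 + 8 * K ^ 2 / c) with hR0
  -- maximum
  set Ψ : Euc n × Euc n → ℝ := fun p => (-ε - w p.1) * fderiv ℝ (hs w) p.1 p.2 p.2 p.2 /
    (hs w p.1 p.2 p.2 * √(hs w p.1 p.2 p.2)) with hΨ
  have hcomp : IsCompact ({x | x ∈ S ∧ w x ≤ -ε} ×ˢ Metric.sphere (0 : Euc n) 1) :=
    (s.sub_closed hε).prod (isCompact_sphere _ _)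
  have hΨc : ContinuousOn Ψ ({x | x ∈ S ∧ w x ≤ -ε} ×ˢ Metric.sphere (0 : Euc n) 1) := by
    have hm : MapsTo (Prod.fst : Euc n × Euc n → Euc n)
      ({x | x ∈ S ∧ w x ≤ -ε} ×ˢ Metric.sphere (0 : Euc n) 1) S := fun p hp => hp.1.1
    have c0 : ContinuousOn (fun p : Euc n × Euc n => w p.1) _ :=
      hsm.continuousOn.comp continuousOn_fst hm
    have c1 : ContinuousOn (fun p : Euc n × Euc n => hs w p.1) _ :=
      (hs_contDiffOn hop hsm).continuousOn.comp continuousOn_fst hm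
    have c2 : ContinuousOn (fun p : Euc n × Euc n => fderiv ℝ (hs w) p.1) _ :=
      (((hs_contDiffOn hop hsm).fderiv_of_isOpen (m := (⊤ : ℕ∞)) hop (by simp)).continuousOn).comp
        continuousOn_fst hm
    have c3 : ContinuousOn (fun p : Euc n × Euc n => hs w p.1 p.2 p.2) _ :=
      (c1.clm_apply continuousOn_snd).clm_apply continuousOn_snd
    have c4 : ContinuousOn (fun p : Euc n × Euc n => fderiv ℝ (hs w) p.1 p.2 p.2 p.2) _ :=
      ((c2.clm_apply continuousOn_snd).clm_apply continuousOn_snd).clm_apply continuousOn_snd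
    refine ContinuousOn.div ((continuousOn_const.sub c0).mul c4) (c3.mul c3.sqrt) ?_
    rintro ⟨p, q⟩ ⟨hp, hq⟩
    have : 0 < hs w p q q := s.pos hp.1 (by
      rintro rfl
      simp at hq)
    positivity
  obtain ⟨ν, hν⟩ := exists_unit s.hn
  obtain ⟨⟨x0, e0⟩, ⟨⟨hx0, hwx0⟩, he0⟩, hmax⟩ := hcomp.exists_isMaxOn
    ⟨(x, ν), ⟨hx, hwx⟩, by simpa using hν⟩ hΨc
  simp only at hx0 hwx0 he0
  set R := Ψ (x0, e0) with hR
  have hall : ∀ y ∈ S, w y ≤ -ε → ∀ e, (-ε - w y) * t3 w y e e e ≤ R * (hs w y e e * √(hs w y e e)) := by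
    intro y hy hwy e
    rcases eq_or_ne e 0 with rfl | he
    · rw [t3_eq hop hsm hy]; simp
    have hen : 0 < ‖e‖ := norm_pos_iff.2 he
    set e' := ‖e‖⁻¹ • e with he'
    have hee : e = ‖e‖ • e' := by rw [he', smul_smul, mul_inv_cancel₀ hen.ne', one_smul]
    have hn' : ‖e'‖ = 1 := by rw [he', norm_smul, norm_inv, norm_norm, inv_mul_cancel₀ hen.ne']
    have h1 := hmax (show (y, e') ∈ _ from ⟨⟨hy, hwy⟩, by simpa using hn'⟩)
    simp only [mem_ofPred_eq] at h1
    have hQ : 0 < hs w y e' e' := s.pos hy (by rintro h; rw [h] at hn'; simp at hn')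
    change (-ε - w y) * fderiv ℝ (hs w) y e' e' e' / (hs w y e' e' * √(hs w y e' e')) ≤ R at h1
    rw [← t3_eq hop hsm hy, div_le_iff₀ (by positivity)] at h1
    rw [hee, t3_hom hop hsm hy, hs_hom, Real.sqrt_mul (by positivity), Real.sqrt_sq hen.le]
    have := mul_le_mul_of_nonneg_left h1 (show 0 ≤ ‖e‖ ^ 3 by positivity)
    calc _ = ‖e‖ ^ 3 * ((-ε - w y) * t3 w y e' e' e') := by ring
      _ ≤ _ := this
      _ = _ := by ring
  refine (hall x hx hwx e).trans ?_
  have hpsd := s.psd hx e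
  refine mul_le_mul_of_nonneg_right ?_ (by positivity)
  rcases le_or_gt R 0 with hRneg | hRpos
  · exact hRneg.trans (Real.sqrt_nonneg _)
  -- normalise
  have he0n : ‖e0‖ = 1 := by simpa using he0
  have he00 : e0 ≠ 0 := by rintro rfl; simp at he0n
  have hQ0 : 0 < hs w x0 e0 e0 := s.pos hx0 he00
  set e1 := (√(hs w x0 e0 e0))⁻¹ • e0 with he1
  have hsq : 0 < √(hs w x0 e0 e0) := Real.sqrt_pos.2 hQ0
  have hQ1 : hs w x0 e1 e1 = 1 := by
    rw [he1, hs_hom, inv_pow, Real.sq_sqrt hQ0.le, inv_mul_cancel₀ hQ0.ne']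
  set M := t3 w x0 e1 e1 e1 with hM
  set σ := -ε - w x0 with hσ
  have hσM : σ * M = R := by
    rw [hM, he1, t3_hom hop hsm hx0, hR]
    change _ = (-ε - w x0) * fderiv ℝ (hs w) x0 e0 e0 e0 / (hs w x0 e0 e0 * √(hs w x0 e0 e0))
    rw [← t3_eq hop hsm hx0, ← hσ]
    have : hs w x0 e0 e0 * √(hs w x0 e0 e0) = √(hs w x0 e0 e0) ^ 3 := by
      rw [pow_succ, Real.sq_sqrt hQ0.le]
    rw [this]
    field_simp
  have hσ0 : 0 < σ := by
    have h1 : 0 ≤ σ := by simp only [hσ]; linarith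
    rcases h1.eq_or_lt with h | h
    · exfalso; rw [← h] at hσM; linarith
    · exact h
  have hM0 : 0 < M := by
    by_contra hcon
    push Not at hcon
    nlinarith
  -- first order condition in e
  have hfo : ∀ v, t3 w x0 e1 e1 v = M * hs w x0 e1 v := by
    intro v
    have hloc : IsLocalMax (fun t : ℝ => σ * t3 w x0 (e1 + t • v) (e1 + t • v) (e1 + t • v)
        - R * (hs w x0 (e1 + t • v) (e1 + t • v) * √(hs w x0 (e1 + t • v) (e1 + t • v)))) 0 := by
      filter_upwards with t
      have := hall x0 hx0 hwx0 (e1 + t • v)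
      simp only [zero_smul, add_zero, hQ1, ← hM, Real.sqrt_one]
      rw [hσM]
      linarith
    have hcub : (fun t : ℝ => σ * t3 w x0 (e1 + t • v) (e1 + t • v) (e1 + t • v)
        - R * (hs w x0 (e1 + t • v) (e1 + t • v) * √(hs w x0 (e1 + t • v) (e1 + t • v)))) =
        fun t : ℝ => σ * (M + (3 * t3 w x0 e1 e1 v * t + 3 * t3 w x0 e1 v v * t ^ 2
          + t3 w x0 v v v * t ^ 3)) - R * ((1 + (2 * hs w x0 e1 v * t + hs w x0 v v * t ^ 2))
          * √(1 + (2 * hs w x0 e1 v * t + hs w x0 v v * t ^ 2))) := by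
      funext t
      rw [t3_cube hop hsm hx0, hs_sq hop hsm hx0, hQ1, ← hM,
        show 1 + 2 * t * hs w x0 e1 v + t ^ 2 * hs w x0 v v
          = 1 + (2 * hs w x0 e1 v * t + hs w x0 v v * t ^ 2) by ring]
      ring
    rw [hcub] at hloc
    have dP : HasDerivAt (fun t : ℝ => M + (3 * t3 w x0 e1 e1 v * t + 3 * t3 w x0 e1 v v * t ^ 2
          + t3 w x0 v v v * t ^ 3)) (3 * t3 w x0 e1 e1 v) 0 := by
      have := ((((hasDerivAt_id (0 : ℝ)).const_mul (3 * t3 w x0 e1 e1 v)).add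
        ((hasDerivAt_pow 2 (0 : ℝ)).const_mul (3 * t3 w x0 e1 v v))).add
        ((hasDerivAt_pow 3 (0 : ℝ)).const_mul (t3 w x0 v v v))).const_add M
      exact this.congr_deriv (by simp)
    have dQ : HasDerivAt (fun t : ℝ => 1 + (2 * hs w x0 e1 v * t + hs w x0 v v * t ^ 2))
        (2 * hs w x0 e1 v) 0 := by
      have := (((hasDerivAt_id (0 : ℝ)).const_mul (2 * hs w x0 e1 v)).add
        ((hasDerivAt_pow 2 (0 : ℝ)).const_mul (hs w x0 v v))).const_add 1
      exact this.congr_deriv (by simp)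
    have dS := dQ.sqrt (by simp)
    have := hloc.hasDerivAt_eq_zero ((dP.const_mul σ).sub ((dQ.mul dS).const_mul R))
    simp at this
    rw [← hσM] at this
    have h3 : σ * (t3 w x0 e1 e1 v - M * hs w x0 e1 v) = 0 := by linarith
    rcases mul_eq_zero.1 h3 with h | h
    · linarith
    · linarith
  -- frame
  have sm1 := dd_smooth hop hsm e1
  have sm2 := dd_smooth hop sm1 e1
  have sm3 := dd_smooth hop sm2 e1
  obtain ⟨v, l, hv, hl, hfr, hB⟩ := frame (hs w x0) (hs (dd e1 w) x0) (s.symm hx0)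
    (fun a b => hs_symm ((smooth_two sm1).contDiffAt (hop.mem_nhds hx0)) a b)
    (fun a ha => s.pos hx0 ha)
  obtain ⟨j1, j2, j3⟩ := jets hop hsm hx0 s.det e1 v l hv hl hB
  have hll : ∀ i, t3 w x0 e1 (v i) (v i) = l i := by
    intro i
    rw [t3_comm1 hop hsm hx0, t3_comm2 hop hsm hx0, t3_hs hop hsm hx0, hl]; simp
  set E : Fin n → ℝ := fun i => hs w x0 e1 (v i) with hE
  have hev : ∀ F : Euc n →L[ℝ] ℝ, F e1 = ∑ i, E i * F (v i) := by
    intro F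
    conv_lhs => rw [hfr e1]
    simp [hE]
  have hE1 : ∑ i, E i ^ 2 = 1 := by
    have := hev (hs w x0 e1)
    rw [hQ1] at this
    rw [this]
    exact Finset.sum_congr rfl fun i _ => by simp only [hE]; ring
  have hlE : ∀ i, l i * E i = M * E i := by
    intro i
    rw [hE]
    simp only
    rw [← hfo (v i), t3_comm2 hop hsm hx0, t3_comm1 hop hsm hx0, t3_hs hop hsm hx0,
      hev (hs (dd e1 w) x0 (v i))]
    simp only [hl]
    simp [hE, mul_comm]
  have hlM : ∀ i, l i ≤ M := by
    intro i
    by_cases hEi : E i = 0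
    · have q1 := hall x0 hx0 hwx0 (e1 + (1 : ℝ) • v i)
      have q2 := hall x0 hx0 hwx0 (e1 + (-1 : ℝ) • v i)
      have hEi' : hs w x0 e1 (v i) = 0 := hEi
      rw [t3_cube hop hsm hx0, hs_sq hop hsm hx0, hQ1, ← hM, hEi', hv, hfo, hEi', hll, ← hσ] at q1 q2
      simp only [if_true] at q1 q2
      norm_num at q1 q2
      rw [← hσM] at q1 q2
      have hsqrt : √2 ≤ 3 / 2 := by
        rw [Real.sqrt_le_left (by norm_num)]; norm_num
      have h5 : σ * (2 * M + 6 * l i) ≤ σ * (M * (4 * √2)) := by nlinarith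
      have h6 := le_of_mul_le_mul_left h5 hσ0
      nlinarith
    · exact (mul_right_cancel₀ hEi (hlE i)).le
  have hlsum : M ^ 2 ≤ ∑ i, l i ^ 2 := by
    have : ∃ i, E i ≠ 0 := by
      by_contra hcon
      push Not at hcon
      simp [hcon] at hE1
    obtain ⟨i, hi⟩ := this
    rw [← mul_right_cancel₀ hi (hlE i)]
    exact Finset.single_le_sum (f := fun i => l i ^ 2) (fun j _ => sq_nonneg _) (Finset.mem_univ i)
  have hcont : ContinuousAt w x0 := hsm.continuousOn.continuousAt (hop.mem_nhds hx0)
  -- test along v i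
  have test : ∀ i, -1 / σ - 2 * (dd (v i) w x0) ^ 2 / σ ^ 2
      + (dd (v i) (dd (v i) (dd e1 (dd e1 (dd e1 w)))) x0
        - 3 * (l i * dd (v i) (dd (v i) (dd e1 (dd e1 w))) x0) + 3 / 2 * l i ^ 3) / M
      - 3 / 2 * (dd (v i) (dd (v i) (dd e1 (dd e1 w))) x0 - 3 / 2 * l i ^ 2) ≤ 0 := by
    intro i
    set V := v i with hV
    set κ := - l i / 2 with hκ
    have smv := dd_smooth hop hsm V
    have k1 : dd V (dd e1 (dd e1 w)) x0 = M * E i :=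
      (dd_swap hop hsm V e1 hx0).trans (hfo V)
    have k2 : dd V (dd e1 w) x0 = E i := by
      rw [dd_dd hop hsm hx0, s.symm hx0]
    have k3 : dd V (dd V (dd e1 w)) x0 = l i := by
      rw [dd_dd hop sm1 hx0, hl]; simp
    have k4 : dd V (dd V w) x0 = 1 := by
      rw [dd_dd hop hsm hx0, hv]; simp
    obtain ⟨Q1, Q10, hQ', hQ''⟩ := cubic_jet (2 * κ) (κ ^ 2) 0
      (dd_line hop sm2 hx0 V) (dd_line hop (dd_smooth hop sm1 V) hx0 V)
      (dd_line hop (dd_smooth hop smv V) hx0 V) (dd_line hop hsm hx0 V)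
      (dd_line0 hop (dd_smooth hop sm2 V) hx0 V)
      (dd_line0 hop (dd_smooth hop (dd_smooth hop sm1 V) V) hx0 V)
      (dd_line0 hop (dd_smooth hop (dd_smooth hop smv V) V) hx0 V)
      (dd_line0 hop smv hx0 V)
    obtain ⟨P1, P10, hP', hP''⟩ := cubic_jet (3 * κ) (3 * κ ^ 2) (κ ^ 3)
      (dd_line hop sm3 hx0 V) (dd_line hop (dd_smooth hop sm2 V) hx0 V)
      (dd_line hop (dd_smooth hop (dd_smooth hop sm1 V) V) hx0 V)
      (dd_line hop (dd_smooth hop (dd_smooth hop smv V) V) hx0 V)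
      (dd_line0 hop (dd_smooth hop sm3 V) hx0 V)
      (dd_line0 hop (dd_smooth hop (dd_smooth hop sm2 V) V) hx0 V)
      (dd_line0 hop (dd_smooth hop (dd_smooth hop (dd_smooth hop sm1 V) V) V) hx0 V)
      (dd_line0 hop (dd_smooth hop (dd_smooth hop (dd_smooth hop smv V) V) V) hx0 V)
    set Q : ℝ → ℝ := fun t => dd e1 (dd e1 w) (x0 + t • V) + 2 * κ * t * dd V (dd e1 w) (x0 + t • V)
      + κ ^ 2 * t ^ 2 * dd V (dd V w) (x0 + t • V) + 0 * t ^ 3 * w (x0 + t • V) with hQdef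
    set P : ℝ → ℝ := fun t => dd e1 (dd e1 (dd e1 w)) (x0 + t • V)
      + 3 * κ * t * dd V (dd e1 (dd e1 w)) (x0 + t • V)
      + 3 * κ ^ 2 * t ^ 2 * dd V (dd V (dd e1 w)) (x0 + t • V)
      + κ ^ 3 * t ^ 3 * dd V (dd V (dd V w)) (x0 + t • V) with hPdef
    have Qe : ∀ t, x0 + t • V ∈ S →
        hs w (x0 + t • V) (e1 + (κ * t) • V) (e1 + (κ * t) • V) = Q t := by
      intro t ht
      rw [hs_sq hop hsm ht, hQdef]
      simp only
      rw [dd_dd hop hsm ht, dd_dd hop hsm ht, dd_dd hop hsm ht, s.symm ht V e1]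
      ring
    have Pe : ∀ t, x0 + t • V ∈ S →
        t3 w (x0 + t • V) (e1 + (κ * t) • V) (e1 + (κ * t) • V) (e1 + (κ * t) • V) = P t := by
      intro t ht
      rw [t3_cube hop hsm ht, hPdef]
      simp only [t3]
      rw [← dd_swap hop hsm V e1 ht, dd_swap hop hsm e1 V ht]
      ring
    have Q00 : Q 0 = 1 := by
      simp only [hQdef, zero_smul, add_zero]
      rw [dd_dd hop hsm hx0, hQ1]; ring
    have P00 : P 0 = M := by
      simp only [hPdef, zero_smul, add_zero]
      rw [hM, t3]; ring
    simp only [zero_smul, add_zero, k1, k2, k3, k4] at Q10 P10 hQ'' hP''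
    have Q10' : Q1 0 = 0 := by
      rw [Q10]
      have := hlE i
      simp only [hκ]; linarith
    have Qpos : ∀ᶠ t in 𝓝 (0 : ℝ), 0 < Q t :=
      (hQ'.self_of_nhds.continuousAt).eventually (lt_mem_nhds (by rw [Q00]; norm_num))
    have T := log_test (s := fun t => -ε - w (x0 + t • V))
      (s1 := fun t => - dd V w (x0 + t • V)) (s2 := - dd V (dd V w) x0)
      (m := P) (m1 := P1)
      (W := fun t => -(3 / 2) * Real.log (Q t))
      (W1 := fun t => -(3 / 2) * (Q1 t / Q t))
      (by simp only [zero_smul, add_zero]; exact hσ0) (by rw [P00]; exact hM0)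
      (by
        filter_upwards [dd_line hop hsm hx0 V] with t ht
        exact ht.const_sub (-ε))
      ((dd_line0 hop smv hx0 V).neg) hP' hP''
      (by
        filter_upwards [hQ', Qpos] with t ht hp
        exact (ht.log hp.ne').const_mul _)
      ((hQ''.div hQ'.self_of_nhds (by rw [Q00]; norm_num)).const_mul _)
      (by
        have hc : Continuous (fun t : ℝ => x0 + t • V) := by fun_prop
        have hw : ∀ᶠ t in 𝓝 (0 : ℝ), w (x0 + t • V) < -ε := by
          have : ContinuousAt (fun t : ℝ => w (x0 + t • V)) 0 := by
            apply ContinuousAt.comp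
            · simpa using hcont
            · exact hc.continuousAt
          refine this.eventually (gt_mem_nhds ?_)
          simp only [zero_smul, add_zero]
          linarith
        filter_upwards [line_mem hop hx0 V, hw, Qpos] with t ht1 ht2 hp
        have h1 := hall _ ht1 ht2.le (e1 + (κ * t) • V)
        rw [Qe t ht1, Pe t ht1] at h1
        have h2 := mul_le_mul_of_nonneg_left h1 (Real.exp_pos (-(3 / 2) * Real.log (Q t))).le
        have h3 := exp_sqrt hp
        simp only [zero_smul, add_zero, ← hσ, Q00, P00, Real.log_one, mul_zero, Real.exp_zero, mul_one]
        rw [hσM]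
        calc _ = Real.exp (-(3 / 2) * Real.log (Q t)) * ((-ε - w (x0 + t • V)) * P t) := by ring
          _ ≤ _ := h2
          _ = R * (Real.exp (-(3 / 2) * Real.log (Q t)) * (Q t * √(Q t))) := by ring
          _ = R := by rw [h3, mul_one])
    simp only [zero_smul, add_zero, ← hσ, Q00, P00, Q10', k4] at T
    obtain ⟨T1, T2⟩ := T
    have hpm : P1 0 / M = dd V w x0 / σ := by
      have e1 : -dd V w x0 / σ = -(dd V w x0 / σ) := by ring
      linarith
    rw [hpm] at T2
    have e2 : (-dd V w x0 / σ) ^ 2 = (dd V w x0) ^ 2 / σ ^ 2 := by rw [div_pow, neg_sq]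
    have e3 : (dd V w x0 / σ) ^ 2 = (dd V w x0) ^ 2 / σ ^ 2 := by rw [div_pow]
    have e4 : 2 * (dd V w x0) ^ 2 / σ ^ 2 = 2 * ((dd V w x0) ^ 2 / σ ^ 2) := by ring
    rw [e2, e3] at T2
    rw [e4]
    set b := dd V (dd V (dd e1 (dd e1 w))) x0
    set cc := dd V (dd V (dd e1 (dd e1 (dd e1 w)))) x0
    have e5 : cc + 2 * (3 * κ) * b + 2 * (3 * κ ^ 2) * l i
        = cc - 3 * (l i * b) + 3 / 2 * l i ^ 3 := by simp only [hκ]; ring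
    have e6 : b + 2 * (2 * κ) * l i + 2 * κ ^ 2 * 1 = b - 3 / 2 * l i ^ 2 := by simp only [hκ]; ring
    rw [e5, e6] at T2
    simp only [mul_one, mul_zero, sub_zero, one_pow, div_one] at T2
    linarith
  -- gradient sum
  set Z := ∑ i, (dd (v i) w x0) ^ 2 with hZ
  have hZ0 : 0 ≤ Z := Finset.sum_nonneg fun i _ => sq_nonneg _
  have hZK : Z ≤ K ^ 2 / c := by
    set V := ∑ i, dd (v i) w x0 • v i with hV
    have h1 : dd V w x0 = Z := by
      unfold dd
      rw [hV, map_sum]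
      simp [dd, hZ, sq]
    have h2 : hs w x0 V V = Z := by
      have h3 : ∀ i, hs w x0 V (v i) = dd (v i) w x0 := by
        intro i
        rw [hV, map_sum, _root_.sum_apply]
        simp [hv]
      have hmap : ∀ F : Euc n →L[ℝ] ℝ, F V = ∑ i, dd (v i) w x0 * F (v i) := by
        intro F
        rw [hV, map_sum]
        simp
      rw [hmap (hs w x0 V)]
      simp only [h3, hZ, sq]
    have h3 := hlow x0 hx0 hwx0 V
    have h4 := (le_abs_self _).trans (hg x0 hx0 hwx0 V)
    rw [h1] at h4
    rw [h2] at h3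
    rw [le_div_iff₀ hc]
    rcases hZ0.eq_or_lt with h | h
    · rw [← h]; simp; positivity
    · have h5 : Z ^ 2 ≤ K ^ 2 * ‖V‖ ^ 2 := by rw [← mul_pow]; exact pow_le_pow_left₀ hZ0 h4 2
      have h6 : Z * (Z * c) ≤ Z * K ^ 2 := by nlinarith [sq_nonneg K]
      exact le_of_mul_le_mul_left h6 h
  have hsum := Finset.sum_nonpos (s := Finset.univ) (fun i _ => test i)
  simp only [Finset.sum_add_distrib, Finset.sum_sub_distrib, ← Finset.mul_sum, ← Finset.sum_div,
    ← hZ, j2, j3, Finset.sum_const, Finset.card_univ, Fintype.card_fin, nsmul_eq_mul] at hsum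
  have hcube : (∑ i, l i ^ 3) / M ≤ ∑ i, l i ^ 2 := by
    rw [div_le_iff₀ hM0, Finset.sum_mul]
    refine Finset.sum_le_sum fun i _ => ?_
    rw [pow_succ]
    exact mul_le_mul_of_nonneg_left (hlM i) (sq_nonneg _)
  have hbig : M ^ 2 / 4 ≤ n / σ + 2 * Z / σ ^ 2 := by
    have ea : (n : ℝ) * -1 / σ = -(n / σ) := by ring
    have e2 : (3 * ∑ i, l i * dd (v i) (dd (v i) (dd e1 (dd e1 w))) x0 - 2 * ∑ i, l i ^ 3
      - 3 * ∑ i, l i * dd (v i) (dd (v i) (dd e1 (dd e1 w))) x0 + 3 / 2 * ∑ i, l i ^ 3) / M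
      = - (1 / 2) * ((∑ i, l i ^ 3) / M) := by ring
    rw [ea, e2] at hsum
    linarith
  have hfin : (σ * M) ^ 2 ≤ 2 * (n : ℝ) ^ 3 + 8 * K ^ 2 / c := by
    have h1 := mul_le_mul_of_nonneg_right hbig (show 0 ≤ 4 * σ ^ 2 by positivity)
    have h2 : (n / σ + 2 * Z / σ ^ 2) * (4 * σ ^ 2) = 4 * n * σ + 8 * Z := by field_simp; ring
    rw [h2] at h1
    have h3 : σ ≤ (n : ℝ) ^ 2 / 2 := by
      have := s.lower hx0
      simp only [hσ]; linarith
    have h4 : 4 * (n : ℝ) * σ ≤ 4 * n * ((n : ℝ) ^ 2 / 2) := by gcongr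
    have h5 : 8 * K ^ 2 / c = 8 * (K ^ 2 / c) := by ring
    rw [h5]
    nlinarith
  rw [← hσM, hR0]
  exact Real.le_sqrt_of_sq_le hfin

end Sol
end SPF

namespace SPF
open Matrix Filter Topology Set

variable {n : ℕ} {S : Set (Euc n)} {ξ : Euc n} {w f : Euc n → ℝ}

lemma bm_quad (B : Euc n →L[ℝ] Euc n →L[ℝ] ℝ) (y : Fin n → ℝ) :
    y ⬝ᵥ (bm B *ᵥ y) = B (WithLp.toLp 2 y) (WithLp.toLp 2 y) := by
  rw [bilin_eq]

lemma dot_norm (y : Fin n → ℝ) : y ⬝ᵥ y = ‖(WithLp.toLp 2 y : Euc n)‖ ^ 2 := by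
  rw [EuclideanSpace.real_norm_sq_eq]
  simp [dotProduct, sq]

lemma herm_smul_one (c : ℝ) : (c • (1 : Matrix (Fin n) (Fin n) ℝ)).IsHermitian := by
  unfold Matrix.IsHermitian; simp

lemma bm_upper {B : Euc n →L[ℝ] Euc n →L[ℝ] ℝ} (hB : ∀ a b, B a b = B b a) {C : ℝ} :
    (C • (1 : Matrix (Fin n) (Fin n) ℝ) - bm B).PosSemidef ↔ ∀ e, B e e ≤ C * ‖e‖ ^ 2 := by
  constructor
  · intro h e
    have := h.dotProduct_mulVec_nonneg (fun i => e i)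
    simp only [sub_mulVec, dotProduct_sub, smul_mulVec, one_mulVec, dotProduct_smul, smul_eq_mul,
      star_trivial, bm_quad, dot_norm] at this
    linarith
  · intro h
    refine .of_dotProduct_mulVec_nonneg ((herm_smul_one C).sub (bm_symm hB)) fun y => ?_
    simp only [sub_mulVec, dotProduct_sub, smul_mulVec, one_mulVec, dotProduct_smul, smul_eq_mul,
      star_trivial, bm_quad, dot_norm]
    linarith [h (WithLp.toLp 2 y)]

lemma bm_lower {B : Euc n →L[ℝ] Euc n →L[ℝ] ℝ} (hB : ∀ a b, B a b = B b a) {C : ℝ} :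
    (bm B - C • (1 : Matrix (Fin n) (Fin n) ℝ)).PosSemidef ↔ ∀ e, C * ‖e‖ ^ 2 ≤ B e e := by
  constructor
  · intro h e
    have := h.dotProduct_mulVec_nonneg (fun i => e i)
    simp only [sub_mulVec, dotProduct_sub, smul_mulVec, one_mulVec, dotProduct_smul, smul_eq_mul,
      star_trivial, bm_quad, dot_norm] at this
    linarith
  · intro h
    refine .of_dotProduct_mulVec_nonneg ((bm_symm hB).sub (herm_smul_one C)) fun y => ?_
    simp only [sub_mulVec, dotProduct_sub, smul_mulVec, one_mulVec, dotProduct_smul, smul_eq_mul,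
      star_trivial, bm_quad, dot_norm]
    linarith [h (WithLp.toLp 2 y)]

lemma exists_smul_unit {e : Euc n} (he : e ≠ 0) : ∃ e' : Euc n, ‖e'‖ = 1 ∧ e = ‖e‖ • e' := by
  have hen : 0 < ‖e‖ := norm_pos_iff.2 he
  refine ⟨‖e‖⁻¹ • e, ?_, ?_⟩
  · rw [norm_smul, norm_inv, norm_norm, inv_mul_cancel₀ hen.ne']
  · rw [smul_smul, mul_inv_cancel₀ hen.ne', one_smul]

lemma bilin_norm {B : Euc n →L[ℝ] Euc n →L[ℝ] ℝ} (hB : ∀ a b, B a b = B b a) {C : ℝ} (hC : 0 ≤ C)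
    (h0 : ∀ e, 0 ≤ B e e) (h1 : ∀ e, B e e ≤ C * ‖e‖ ^ 2) : ‖B‖ ≤ C := by
  have unit : ∀ a b : Euc n, ‖a‖ = 1 → ‖b‖ = 1 → |B a b| ≤ C := by
    intro a b ha hb
    have p1 := h1 (a + b)
    have p2 := h1 (a - b)
    have p3 := h0 (a + b)
    have p4 := h0 (a - b)
    have n1 : ‖a + b‖ ^ 2 ≤ 4 := by
      have := norm_add_le a b
      nlinarith [norm_nonneg (a + b)]
    have n2 : ‖a - b‖ ^ 2 ≤ 4 := by
      have := norm_sub_le a b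
      nlinarith [norm_nonneg (a - b)]
    have q1 := mul_le_mul_of_nonneg_left n1 hC
    have q2 := mul_le_mul_of_nonneg_left n2 hC
    have s := hB b a
    simp at p1 p2 p3 p4
    rw [abs_le]
    constructor <;> linarith
  refine ContinuousLinearMap.opNorm_le_bound _ hC fun a => ?_
  refine ContinuousLinearMap.opNorm_le_bound _ (by positivity) fun b => ?_
  rcases eq_or_ne a 0 with rfl | ha
  · simp
  rcases eq_or_ne b 0 with rfl | hb
  · simp
  obtain ⟨a', ha', hae⟩ := exists_smul_unit ha
  obtain ⟨b', hb', hbe⟩ := exists_smul_unit hb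
  have := unit a' b' ha' hb'
  have e : B a b = ‖a‖ * ‖b‖ * B a' b' := by
    conv_lhs => rw [hae, hbe]
    simp
    ring
  rw [e, Real.norm_eq_abs, abs_mul, abs_of_nonneg (by positivity : 0 ≤ ‖a‖ * ‖b‖)]
  have := mul_le_mul_of_nonneg_left this (by positivity : 0 ≤ ‖a‖ * ‖b‖)
  linarith

set_option synthInstance.maxHeartbeats 400000 in
set_option maxSynthPendingDepth 6 in
set_option maxHeartbeats 1600000 in
lemma trilin_norm {T : Euc n →L[ℝ] Euc n →L[ℝ] Euc n →L[ℝ] ℝ} (h12 : ∀ a b c, T a b c = T b a c)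
    (h23 : ∀ a b c, T a b c = T a c b) {C : ℝ} (hC : 0 ≤ C)
    (h1 : ∀ e, |T e e e| ≤ C * ‖e‖ ^ 3) : ‖T‖ ≤ 5 * C := by
  have unit : ∀ a b c : Euc n, ‖a‖ = 1 → ‖b‖ = 1 → ‖c‖ = 1 → |T a b c| ≤ 5 * C := by
    intro a b c ha hb hc
    have bound : ∀ e : Euc n, ‖e‖ ≤ 3 → |T e e e| ≤ 27 * C := by
      intro e he
      refine (h1 e).trans ?_
      have := pow_le_pow_left₀ (norm_nonneg e) he 3
      have := mul_le_mul_of_nonneg_left this hC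
      linarith
    have n1 := abs_le.1 (bound (a + b + c) (by
      have := norm_add_le (a + b) c; have := norm_add_le a b; linarith))
    have n2 := abs_le.1 (bound (a + b - c) (by
      have := norm_sub_le (a + b) c; have := norm_add_le a b; linarith))
    have n3 := abs_le.1 (bound (a - b + c) (by
      have := norm_add_le (a - b) c; have := norm_sub_le a b; linarith))
    have n4 := abs_le.1 (bound (a - b - c) (by
      have := norm_sub_le (a - b) c; have := norm_sub_le a b; linarith))
    have key : T (a + b + c) (a + b + c) (a + b + c) - T (a + b - c) (a + b - c) (a + b - c)
        - T (a - b + c) (a - b + c) (a - b + c) + T (a - b - c) (a - b - c) (a - b - c)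
        = 24 * T a b c := by
      simp only [map_add, map_sub, _root_.add_apply, _root_.sub_apply]
      have r1 : T a c b = T a b c := h23 _ _ _
      have r2 : T b a c = T a b c := h12 _ _ _
      have r3 : T b c a = T a b c := by rw [h23, h12]
      have r4 : T c a b = T a b c := by rw [h12, h23]
      have r5 : T c b a = T a b c := by rw [h23, h12, h23]
      rw [r1, r2, r3, r4, r5]
      ring
    rw [abs_le]
    constructor <;> linarith
  refine ContinuousLinearMap.opNorm_le_bound _ (by positivity) fun a => ?_
  refine ContinuousLinearMap.opNorm_le_bound _ (by positivity) fun b => ?_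
  refine ContinuousLinearMap.opNorm_le_bound _ (by positivity) fun c => ?_
  rcases eq_or_ne a 0 with rfl | ha
  · simp
  rcases eq_or_ne b 0 with rfl | hb
  · simp
  rcases eq_or_ne c 0 with rfl | hc
  · simp
  obtain ⟨a', ha', hae⟩ := exists_smul_unit ha
  obtain ⟨b', hb', hbe⟩ := exists_smul_unit hb
  obtain ⟨c', hc', hce⟩ := exists_smul_unit hc
  have := unit a' b' c' ha' hb' hc'
  have e : T a b c = ‖a‖ * ‖b‖ * ‖c‖ * T a' b' c' := by
    conv_lhs => rw [hae, hbe, hce]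
    simp
    ring
  rw [e, Real.norm_eq_abs, abs_mul, abs_of_nonneg (by positivity : 0 ≤ ‖a‖ * ‖b‖ * ‖c‖)]
  have := mul_le_mul_of_nonneg_left this (by positivity : 0 ≤ ‖a‖ * ‖b‖ * ‖c‖)
  linarith

namespace Sol

set_option synthInstance.maxHeartbeats 400000 in
set_option maxSynthPendingDepth 6 in
set_option maxHeartbeats 1600000 in
lemma interior_est (n : ℕ) (hn : 2 ≤ n) (ε : ℝ) (hε : 0 < ε) : ∃ c C C3 d K : ℝ, 0 < c ∧ 0 < C ∧ 0 < C3
    ∧ 0 < d ∧ 0 < K ∧ ∀ (S : Set (Euc n)) (ξ : Euc n) (w : Euc n → ℝ), Sol n S ξ w →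
      (∀ x ∈ S, w x ≤ -(2 * ε) → (∀ e, c * ‖e‖ ^ 2 ≤ hs w x e e) ∧ (∀ e, hs w x e e ≤ C * ‖e‖ ^ 2) ∧
        ‖hs w x‖ ≤ C) ∧
      (∀ x ∈ S, w x ≤ -(3 * ε) → ‖fderiv ℝ (hs w) x‖ ≤ C3) ∧
      (∀ x ∈ S, w x ≤ -ε → Metric.ball x d ⊆ S) ∧
      (∀ x ∈ S, w x ≤ -ε → ∀ e, |dd e w x| ≤ K * ‖e‖) := by
  obtain ⟨d, hd0, hd1, hd⟩ := dist_bd n hn ε hε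
  have hn0 : (0 : ℝ) < n := by exact_mod_cast (by omega : 0 < n)
  set K := (n : ℝ) ^ 2 / d with hK
  have hK0 : 0 < K := by positivity
  set C := (n + K) * Real.exp (K ^ 2 / 2) / ε with hC
  have hC0 : 0 < C := by positivity
  set c := (C ^ (n - 1))⁻¹ with hc
  have hc0 : 0 < c := by positivity
  set R0 := √(2 * (n : ℝ) ^ 3 + 8 * K ^ 2 / c) with hR0
  have hR00 : 0 < R0 := by positivity
  set C3 := R0 * (C * √C) / ε with hC3
  have hC30 : 0 < C3 := by positivity
  refine ⟨c, C, 5 * C3, d, K, hc0, hC0, by positivity, hd0, hK0, ?_⟩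
  intro S ξ w s
  have hgrad : ∀ x ∈ S, w x ≤ -ε → ∀ e, |dd e w x| ≤ K * ‖e‖ := fun x hx hwx e =>
    s.grad_bd hx hd0 (hd S ξ w s x hx hwx) e
  have hup : ∀ x ∈ S, w x ≤ -(2 * ε) → ∀ e, hs w x e e ≤ C * ‖e‖ ^ 2 := by
    intro x hx hwx e
    rcases eq_or_ne e 0 with rfl | he
    · simp
    obtain ⟨e', he', hee⟩ := exists_smul_unit he
    have he0 : e' ≠ 0 := by rintro rfl; simp at he'
    have h1 := s.pogorelov hε hK0.le e' he0 (fun y hy hwy => by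
      have := hgrad y hy hwy e'
      rwa [he', mul_one] at this) hx (by linarith)
    have h2 : ε * hs w x e' e' ≤ (n + K) * Real.exp (K ^ 2 / 2) := by
      refine le_trans ?_ h1
      have p := s.psd hx e'
      refine mul_le_mul_of_nonneg_right ?_ p
      have : 1 ≤ Real.exp ((dd e' w x) ^ 2 / 2) := Real.one_le_exp (by positivity)
      nlinarith
    have h3 : hs w x e' e' ≤ C := by
      rw [hC, le_div_iff₀ hε]; linarith
    rw [hee, hs_hom, norm_smul, he', norm_norm, mul_one]
    have := mul_le_mul_of_nonneg_left h3 (sq_nonneg ‖e‖)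
    linarith
  have hlo : ∀ x ∈ S, w x ≤ -(2 * ε) → ∀ e, c * ‖e‖ ^ 2 ≤ hs w x e e := by
    intro x hx hwx
    have sy := s.symm hx
    rw [← bm_lower sy]
    exact psd_lower (bm_psd sy (s.psd hx)) (s.det x hx) hC0 ((bm_upper sy).2 (hup x hx hwx))
  refine ⟨fun x hx hwx => ⟨hlo x hx hwx, hup x hx hwx,
    bilin_norm (s.symm hx) hC0.le (s.psd hx) (hup x hx hwx)⟩, ?_, hd S ξ w s, hgrad⟩
  intro x hx hwx
  have key : ∀ e, t3 w x e e e ≤ C3 * ‖e‖ ^ 3 := by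
    intro e
    have h1 := s.calabi (ε := 2 * ε) (by positivity) hK0.le hc0
      (fun y hy hwy => hgrad y hy (by linarith)) hlo hx (by linarith) e
    have h2 := hup x hx (by linarith) e
    have h0 := s.psd hx e
    have h3 : hs w x e e * √(hs w x e e) ≤ C * √C * ‖e‖ ^ 3 := by
      calc hs w x e e * √(hs w x e e) ≤ (C * ‖e‖ ^ 2) * √(C * ‖e‖ ^ 2) := by gcongr
        _ = C * √C * ‖e‖ ^ 3 := by
          rw [Real.sqrt_mul hC0.le, Real.sqrt_sq (norm_nonneg _)]; ring
    rcases le_or_gt (t3 w x e e e) 0 with h | h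
    · exact h.trans (by positivity)
    · have h4 : ε * t3 w x e e e ≤ (-(2 * ε) - w x) * t3 w x e e e :=
        mul_le_mul_of_nonneg_right (by linarith) h.le
      have h5 := mul_le_mul_of_nonneg_left h3 hR00.le
      have h6 : ε * t3 w x e e e ≤ ε * (C3 * ‖e‖ ^ 3) := by
        have : ε * (C3 * ‖e‖ ^ 3) = R0 * (C * √C * ‖e‖ ^ 3) := by rw [hC3]; field_simp
        rw [this]
        linarith
      exact le_of_mul_le_mul_left h6 hε
  refine trilin_norm (fun a b c => ?_) (fun a b c => ?_) hC30.le fun e => ?_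
  · rw [← t3_eq s.op s.sm hx, ← t3_eq s.op s.sm hx, t3_comm1 s.op s.sm hx]
  · rw [← t3_eq s.op s.sm hx, ← t3_eq s.op s.sm hx, t3_comm2 s.op s.sm hx]
  · rw [← t3_eq s.op s.sm hx, abs_le]
    constructor
    · have := key ((-1 : ℝ) • e)
      rw [t3_hom s.op s.sm hx, norm_smul] at this
      norm_num at this
      linarith
    · exact key e

end Sol
end SPF

namespace SPF
open Matrix Filter Topology Set

variable {n : ℕ} {S : Set (Euc n)} {ξ : Euc n} {w f u : Euc n → ℝ}

lemma frontier_infinite (hn : 2 ≤ n) (h1 : Metric.ball ξ 1 ⊆ S) (h2 : S ⊆ Metric.ball ξ (n : ℝ)) :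
    (frontier S).Infinite := by
  intro hfin
  have hrank : 1 < Module.rank ℝ (Euc n) := by
    rw [← Module.finrank_eq_rank]
    simp
    exact_mod_cast hn
  have hc := (hfin.countable.isConnected_compl_of_one_lt_rank hrank).isPreconnected
  obtain ⟨ν, hν⟩ := Sol.exists_unit (n := n) hn
  have hcl : closure S ⊆ Metric.closedBall ξ n :=
    (closure_mono h2).trans Metric.closure_ball_subset_closedBall
  have hi : ξ ∈ interior S := interior_maximal h1 Metric.isOpen_ball (Metric.mem_ball_self one_pos)
  set p : Euc n := ξ + ((n : ℝ) + 1) • ν with hp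
  have hpo : p ∉ closure S := by
    intro h
    have := hcl h
    rw [mem_closedBall_iff_norm, hp, add_sub_cancel_left, norm_smul, hν, Real.norm_eq_abs,
      abs_of_nonneg (by positivity)] at this
    linarith
  have hcov : (frontier S)ᶜ ⊆ interior S ∪ (closure S)ᶜ := by
    intro x hx
    by_cases hx1 : x ∈ closure S
    · left
      by_contra h
      exact hx ⟨hx1, h⟩
    · right; exact hx1
  obtain ⟨x, -, hx1, hx2⟩ := hc _ _ isOpen_interior isClosed_closure.isOpen_compl hcov
    ⟨ξ, fun h => h.2 hi, hi⟩ ⟨p, fun h => hpo h.1, hpo⟩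
  exact hx2 (subset_closure (interior_subset hx1))

lemma anti_of_det {B : Euc n →L[ℝ] Euc n →L[ℝ] ℝ} (hB : (bm B).det ≠ 0) :
    ∃ C, AntilipschitzWith C B := by
  have hk : LinearMap.ker (B : Euc n →ₗ[ℝ] Euc n →L[ℝ] ℝ) = ⊥ := by
    rw [LinearMap.ker_eq_bot']
    intro a ha
    have h0 : ∀ b, B a b = 0 := fun b => by
      have : B a = 0 := ha
      rw [this]; rfl
    have h1 : (fun i => a i) ᵥ* bm B = 0 := by
      refine dotProduct_eq_zero _ fun v => ?_
      have := bilin_eq B a (WithLp.toLp 2 v)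
      rw [h0, dotProduct_mulVec] at this
      simpa using this.symm
    have h2 := Matrix.eq_zero_of_vecMul_eq_zero hB h1
    ext i
    exact congrFun h2 i
  obtain ⟨K, -, hK⟩ := LinearMap.exists_antilipschitzWith _ hk
  exact ⟨K, hK⟩

/-- the boundary value is the section level -/
lemma level_zero (hn : 2 ≤ n) {M : ℝ} (hc : ContinuousOn u (closure {z | u z < M}))
    (h1 : Metric.ball ξ 1 ⊆ {z | u z < M}) (h2 : {z | u z < M} ⊆ Metric.ball ξ (n : ℝ))
    (hfr : ∀ z ∈ frontier {z | u z < M}, u z = 0)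
    (hdet : ∀ z ∈ {z | u z < M}, (bm (hs u z)).det ≠ 0) : M = 0 := by
  have hinf := frontier_infinite hn h1 h2
  have hle : 0 ≤ M := by
    obtain ⟨z, hz⟩ := hinf.nonempty
    rw [← hfr z hz]
    have := ContinuousWithinAt.closure_le (s := {z | u z < M}) (f := u) (g := fun _ => M) hz.1
      ((hc z hz.1).mono subset_closure) continuousWithinAt_const (fun y hy => le_of_lt hy)
    exact this
  by_contra hne
  have hpos : 0 < M := lt_of_le_of_ne hle (Ne.symm hne)
  have hin : ∀ z ∈ frontier {z | u z < M}, z ∈ {z | u z < M} := fun z hz => by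
    show u z < M
    rw [hfr z hz]; exact hpos
  have hnd : ∀ z ∈ frontier {z | u z < M}, fderiv ℝ u z = 0 := by
    intro z hz
    refine fderiv_zero_of_not_differentiableAt fun hd => ?_
    refine hz.2 (mem_interior_iff_mem_nhds.2 ?_)
    exact hd.continuousAt.eventually_lt continuousAt_const (hin z hz)
  have hcomp : IsCompact (frontier {z | u z < M}) := by
    refine (isCompact_closedBall ξ (n : ℝ)).of_isClosed_subset isClosed_frontier ?_
    exact frontier_subset_closure.trans
      ((closure_mono h2).trans Metric.closure_ball_subset_closedBall)
  obtain ⟨z, hz, hacc⟩ := hinf.exists_accPt_of_subset_isCompact hcomp subset_rfl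
  have hd := hdet z (hin z hz)
  have hdiff : DifferentiableAt ℝ (fderiv ℝ u) z := by
    by_contra h
    apply hd
    have : hs u z = 0 := fderiv_zero_of_not_differentiableAt h
    rw [this]
    have h0 : bm (0 : Euc n →L[ℝ] Euc n →L[ℝ] ℝ) = 0 := by ext i j; simp [bm]
    rw [h0]
    haveI : Nonempty (Fin n) := ⟨⟨0, by omega⟩⟩
    exact Matrix.det_zero
  have hev := hdiff.hasFDerivAt.eventually_ne (c := 0) (anti_of_det hd)
  obtain ⟨y, hy1, hy2⟩ := ((accPt_iff_frequently_nhdsNE.1 hacc).and_eventually hev).exists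
  exact hy2 (hnd y hy1)

end SPF

namespace SPF
open Matrix Filter Topology Set

variable {n : ℕ} {S : Set (Euc n)} {ξ : Euc n} {w f u g : Euc n → ℝ} {δ : ℝ}

lemma hs_const_mul (hS : IsOpen S) (hf : ContDiffOn ℝ 2 f S) (c : ℝ) {x : Euc n} (hx : x ∈ S) :
    hs (fun y => c * f y) x = c • hs f x := by
  have h1 : fderiv ℝ (fun y => c * f y) =ᶠ[𝓝 x] fun y => c • fderiv ℝ f y := by
    filter_upwards [hS.mem_nhds hx] with y hy
    exact fderiv_const_mul ((hf.contDiffAt (hS.mem_nhds hy)).differentiableAt (by norm_num)) c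
  have h2 : DifferentiableAt ℝ (fderiv ℝ f) x :=
    ((hf.contDiffAt (hS.mem_nhds hx)).fderiv_right (m := 1) (by norm_num)).differentiableAt
      (by norm_num)
  unfold hs
  rw [h1.fderiv_eq, fderiv_fun_const_smul h2]

lemma det_const_mul (hS : IsOpen S) (hf : ContDiffOn ℝ 2 f S) (c : ℝ) {x : Euc n} (hx : x ∈ S) :
    (bm (hs (fun y => c * f y) x)).det = c ^ n * (bm (hs f x)).det := by
  rw [hs_const_mul hS hf c hx]
  have : bm (c • hs f x) = c • bm (hs f x) := by ext i j; simp [bm]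
  rw [this, Matrix.det_smul, Fintype.card_fin]

lemma core (hn : 2 ≤ n) (op : IsOpen S) (cvx : Convex ℝ S) (h1 : Metric.ball ξ 1 ⊆ S)
    (h2 : S ⊆ Metric.ball ξ (n : ℝ)) (huc : ConvexOn ℝ S u) (hu : ContDiffOn ℝ 2 u S)
    (hucl : ContinuousOn u (closure S)) (hneg : ∀ z ∈ S, u z ≤ 0) (hufr : ∀ z ∈ frontier S, u z = 0)
    (hdet : ∀ z ∈ S, (bm (hs u z)).det = g z ^ n) (hg : ∀ z ∈ S, |g z - 1| ≤ δ)
    (hδ0 : 0 ≤ δ) (hδ : δ ≤ 1 / 20)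
    (hwc : ConvexOn ℝ S w) (hw : ContDiffOn ℝ (⊤ : ℕ∞) w S) (hwcl : ContinuousOn w (closure S))
    (hwdet : ∀ z ∈ S, (bm (hs w z)).det = 1) (hwfr : ∀ z ∈ frontier S, w z = 0) :
    Sol n S ξ w ∧ (∀ z ∈ S, (1 + δ) * w z ≤ u z) ∧ (∀ z ∈ S, u z ≤ (1 - δ) * w z) ∧ w ξ ≤ -1 / 2 := by
  have hw2 : ContDiffOn ℝ 2 w S := smooth_two hw
  have hup := fun x hx a => convex_hs op huc hu (x := x) hx a
  have hwp := fun x hx a => convex_hs op hwc hw2 (x := x) hx a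
  have c1 : ∀ z ∈ S, (1 + δ) * w z ≤ u z := by
    refine comparison (by omega) op h2 hu (h := fun y => (1 + δ) * w y) (contDiffOn_const.mul hw2)
      hucl (continuousOn_const.mul hwcl) ?_ ?_ ?_
    · intro x hx a
      rw [hs_const_mul op hw2 _ hx]
      exact mul_nonneg (by linarith) (hwp x hx a)
    · intro x hx
      rw [det_const_mul op hw2 _ hx, hwdet x hx, hdet x hx, mul_one]
      have := abs_le.1 (hg x hx)
      exact pow_le_pow_left₀ (by linarith) (by linarith) n
    · intro x hx
      rw [hwfr x hx, hufr x hx, mul_zero]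
  have c2 : ∀ z ∈ S, u z ≤ (1 - δ) * w z := by
    refine comparison (by omega) op h2 (f := fun y => (1 - δ) * w y) (contDiffOn_const.mul hw2) hu
      (continuousOn_const.mul hwcl) hucl hup ?_ ?_
    · intro x hx
      rw [det_const_mul op hw2 _ hx, hwdet x hx, hdet x hx, mul_one]
      have := abs_le.1 (hg x hx)
      exact pow_le_pow_left₀ (by linarith) (by linarith) n
    · intro x hx
      rw [hwfr x hx, hufr x hx, mul_zero]
  have hwneg : ∀ z ∈ S, w z ≤ 0 := by
    intro z hz
    have := c1 z hz
    have := hneg z hz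
    by_contra hcon
    push Not at hcon
    nlinarith
  have hsol : Sol n S ξ w :=
    ⟨hn, op, cvx, h2, hwc, hw, hwcl, hwdet, hwfr, hwneg⟩
  refine ⟨hsol, c1, c2, ?_⟩
  obtain ⟨ν, hν⟩ := Sol.exists_unit (n := n) hn
  have hwcl0 : ∀ z ∈ closure S, w z ≤ 0 := by
    intro z hz
    by_cases h : z ∈ S
    · exact hwneg z h
    · rw [hwfr z ⟨hz, fun h' => h (interior_subset h')⟩]
  have := comparison (by omega : 0 < n) Metric.isOpen_ball (Ω := Metric.ball ξ 1) subset_rfl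
    (f := bar 1 0 1 0 ξ ν 0) (h := w) (bar_contDiff _ _ _ _ _ _ _).contDiffOn (hw2.mono h1)
    (bar_contDiff _ _ _ _ _ _ _ (k := 0)).continuous.continuousOn (hwcl.mono (closure_mono h1))
    (fun x hx a => hwp x (h1 hx) a)
    (fun x hx => by
      rw [bar_det (by omega) _ _ _ _ one_ne_zero _ _ _ _ hν, hwdet x (h1 hx)]
      simp)
    (fun x hx => by
      have hx1 := closure_mono h1 (frontier_subset_closure hx)
      rw [frontier_ball _ one_ne_zero, mem_sphere_iff_norm] at hx
      have : bar 1 0 1 0 ξ ν 0 x = 0 := by simp [bar, hx]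
      rw [this]
      exact hwcl0 x hx1) ξ (Metric.mem_ball_self one_pos)
  simpa [bar] using this

end SPF

namespace SPF
open Matrix Filter Topology Set

variable {n : ℕ} {S : Set (Euc n)} {ξ : Euc n} {w f u g : Euc n → ℝ} {δ : ℝ}

set_option synthInstance.maxHeartbeats 400000 in
set_option maxSynthPendingDepth 6 in
set_option maxHeartbeats 1600000 in
lemma iter_norm (f : Euc n → ℝ) (x y : Euc n) :
    ‖iteratedFDeriv ℝ 2 f x - iteratedFDeriv ℝ 2 f y‖ ≤ ‖hs f x - hs f y‖ := by
  refine ContinuousMultilinearMap.opNorm_le_bound (norm_nonneg (hs f x - hs f y)) fun m => ?_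
  rw [ContinuousMultilinearMap.sub_apply, iteratedFDeriv_two_apply, iteratedFDeriv_two_apply,
    Fin.prod_univ_two, ← mul_assoc]
  exact (hs f x - hs f y).le_opNorm₂ (m 0) (m 1)

lemma holder_interp {A B C r α : ℝ} (hA : 0 ≤ A) (hB : 0 < B) (hC : 0 < C) (hr : 0 ≤ r)
    (h1 : A ≤ B) (h2 : A ≤ C * r) (hα : α ∈ Icc (0 : ℝ) 1) :
    A ≤ B ^ (1 - α) * C ^ α * r ^ α := by
  rcases hA.eq_or_lt with h | h
  · rw [← h]; positivity
  · calc A = A ^ (1 - α) * A ^ α := by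
          rw [← Real.rpow_add h]; simp
      _ ≤ B ^ (1 - α) * (C * r) ^ α := by
          have := hα.1
          have := hα.2
          gcongr
      _ = B ^ (1 - α) * C ^ α * r ^ α := by
          rw [Real.mul_rpow hC.le hr, mul_assoc]

lemma grad_est (s : Sol n S ξ w) {ε C d K m : ℝ} (hC : 0 < C) (hd : 0 < d) (hK : 0 < K)
    (h0 : (0 : Euc n) ∈ S) (hball : Metric.ball (0 : Euc n) d ⊆ S) (hw0 : w 0 ≤ -(4 * ε))
    (hh : ∀ x ∈ S, w x ≤ -(2 * ε) → ‖hs w x‖ ≤ C) (hg : ∀ e, |dd e w 0| ≤ K * ‖e‖)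
    (hm : ∀ y ∈ S, w 0 - m ≤ w y) : ‖gradient w 0‖ ^ 2 ≤ 4 * (C + 1 + 2 * K / d) * m := by
  set M := C + 1 + 2 * K / d with hM
  have hKd : 0 < K / d := div_pos hK hd
  have hM0 : 0 < M := by rw [hM]; positivity
  have hMd : M * d = C * d + d + 2 * K := by rw [hM]; field_simp
  set p := gradient w 0 with hp
  have hpv : ∀ v, fderiv ℝ w 0 v = inner ℝ p v := by
    intro v
    rw [hp, gradient, InnerProductSpace.toDual_symm_apply]
  have hpp : fderiv ℝ w 0 p = ‖p‖ ^ 2 := by rw [hpv, real_inner_self_eq_norm_sq]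
  have hpK : ‖p‖ ≤ K := by
    have := hg p
    rw [dd, hpp, abs_of_nonneg (by positivity)] at this
    by_contra hcon
    push Not at hcon
    nlinarith
  set y : Euc n := -(1 / (2 * M)) • p with hy
  have hyn : ‖y‖ = ‖p‖ / (2 * M) := by
    rw [hy, norm_smul, norm_neg, Real.norm_eq_abs, abs_of_pos (by positivity)]; ring
  have hyd : ‖y‖ < d / 2 := by
    rw [hyn, div_lt_iff₀ (by positivity)]
    nlinarith
  have hsub : Metric.ball (0 : Euc n) (d / 2) ⊆ S :=
    (Metric.ball_subset_ball (by linarith)).trans hball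
  have hlow : ∀ z ∈ Metric.ball (0 : Euc n) (d / 2), w z ≤ -(2 * ε) := by
    intro z hz
    rw [mem_ball_zero_iff] at hz
    have h2z : (2 : ℝ) • z ∈ S := by
      apply hball
      rw [mem_ball_zero_iff, norm_smul]
      norm_num; linarith
    have := s.cw.2 h0 h2z (by norm_num : (0 : ℝ) ≤ 1 / 2) (by norm_num : (0 : ℝ) ≤ 1 / 2) (by norm_num)
    simp only [smul_zero, zero_add, smul_smul, smul_eq_mul] at this
    norm_num at this
    have hn := s.neg _ h2z
    linarith
  have hmv : ‖fderiv ℝ w y - fderiv ℝ w 0‖ ≤ C * ‖y - 0‖ := by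
    refine (convex_ball (0 : Euc n) (d / 2)).norm_image_sub_le_of_norm_fderiv_le (𝕜 := ℝ) ?_ ?_
      (Metric.mem_ball_self (by linarith)) (by rw [mem_ball_zero_iff]; exact hyd)
    · intro z hz
      exact ((((smooth_two s.sm).contDiffAt (s.op.mem_nhds (hsub hz)))).fderiv_right (m := 1)
        (by norm_num)).differentiableAt (by norm_num)
    · intro z hz
      exact hh z (hsub hz) (hlow z hz)
  have hyS : y ∈ S := hsub (by rw [mem_ball_zero_iff]; exact hyd)
  have hgr := convex_grad s.cw hyS h0 (smooth_diff s.op s.sm hyS)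
  rw [zero_sub, map_neg] at hgr
  rw [sub_zero] at hmv
  have h5 : fderiv ℝ w y y - fderiv ℝ w 0 y ≤ C * ‖y‖ * ‖y‖ := by
    have h6 := (fderiv ℝ w y - fderiv ℝ w 0).le_of_opNorm_le hmv y
    have h7 := le_abs_self ((fderiv ℝ w y - fderiv ℝ w 0) y)
    rw [← Real.norm_eq_abs] at h7
    have h8 := h7.trans h6
    simpa using h8
  have h9 : fderiv ℝ w 0 y = -(‖p‖ ^ 2 / (2 * M)) := by
    rw [hy, map_smul, hpp, smul_eq_mul]; ring
  have h10 := hm y hyS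
  have hCM : C ≤ M := by rw [hM]; have : 0 ≤ 2 * K / d := by positivity
                         linarith
  have h11 : C * ‖y‖ * ‖y‖ ≤ ‖p‖ ^ 2 / (4 * M) := by
    rw [hyn]
    have : ‖p‖ ^ 2 / (4 * M) = M * (‖p‖ / (2 * M)) * (‖p‖ / (2 * M)) := by field_simp; norm_num
    rw [this]
    gcongr
  have h12 : ‖p‖ ^ 2 / (2 * M) = 2 * (‖p‖ ^ 2 / (4 * M)) := by field_simp; norm_num
  have h13 : ‖p‖ ^ 2 / (4 * M) ≤ m := by
    rw [h9, h12] at h5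
    linarith
  rw [div_le_iff₀ (by positivity)] at h13
  linarith

end SPF

namespace SPF
open Filter Topology Set
lemma smooth_diff' {n : ℕ} {S : Set (Euc n)} {F : Euc n → Euc n →L[ℝ] Euc n →L[ℝ] ℝ} (hS : IsOpen S)
    (hF : ContDiffOn ℝ (⊤ : ℕ∞) F S) {x : Euc n} (hx : x ∈ S) : DifferentiableAt ℝ F x :=
  (hF.contDiffAt (hS.mem_nhds hx)).differentiableAt (by simp)
end SPF

set_option synthInstance.maxHeartbeats 400000 in
set_option maxSynthPendingDepth 6 in
set_option maxHeartbeats 1600000 in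
/-- First part of the perturbation lemma for sections: with `S = S(u,L)`
quasi-normalised, `Du(0) = 0`, `u = 0` on `∂S`, `(det D²u)^{1/n} = g`, `g(0) = 1`,
`δ = sup_S |g − 1| ≤ n^{−2}/5`, and `w` the convex solution of `det D²w = 1` in `S`
with zero boundary values, there are dimensional constants `c₂, C₂, C₃ > 0` with:
(a) `|u − w| ≤ n²δ/2` on `S`; (b) `c₂ I ≤ D²w ≤ C₂ I` on `S(u, L/2)`;
(c) the `α`-Hölder seminorm of `D²w` on `S(u,L/2)` is at most `C₂^{1−α} C₃^α`;
(d) `|Dw(0)| ≤ n C₂ (2/c₂)^{1/2} δ^{1/2}`. -/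
theorem section_perturbation_first_part (n : ℕ) (hn : 2 ≤ n) :
    ∃ c₂ C₂ C₃ : ℝ, 0 < c₂ ∧ 0 < C₂ ∧ 0 < C₃ ∧
      ∀ (L : ℝ) (_ : 0 < L) (ξ : Euc n) (u g w : Euc n → ℝ) (δ : ℝ),
        StrictConvexOn ℝ (closure {z : Euc n | u z < u 0 + L}) u →
        ContDiffOn ℝ 2 u (closure {z : Euc n | u z < u 0 + L}) →
        Metric.ball ξ 1 ⊆ {z : Euc n | u z < u 0 + L} →
        {z : Euc n | u z < u 0 + L} ⊆ Metric.ball ξ (n : ℝ) →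
        gradient u 0 = 0 →
        (∀ z ∈ frontier {z : Euc n | u z < u 0 + L}, u z = 0) →
        (∀ z ∈ {z : Euc n | u z < u 0 + L}, hessDet u z = g z ^ n) →
        g 0 = 1 →
        (∀ z ∈ {z : Euc n | u z < u 0 + L}, |g z - 1| ≤ δ) →
        δ ≤ ((n : ℝ) ^ 2)⁻¹ / 5 →
        ConvexOn ℝ {z : Euc n | u z < u 0 + L} w →
        ContDiffOn ℝ (⊤ : ℕ∞) w {z : Euc n | u z < u 0 + L} →
        ContinuousOn w (closure {z : Euc n | u z < u 0 + L}) →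
        (∀ z ∈ {z : Euc n | u z < u 0 + L}, hessDet w z = 1) →
        (∀ z ∈ frontier {z : Euc n | u z < u 0 + L}, w z = 0) →
        (∀ z ∈ {z : Euc n | u z < u 0 + L}, |u z - w z| ≤ (n : ℝ) ^ 2 * δ / 2) ∧
        (∀ x ∈ {z : Euc n | u z < u 0 + L / 2},
          Matrix.PosSemidef (hessianMatrix w x - c₂ • (1 : Matrix (Fin n) (Fin n) ℝ)) ∧
          Matrix.PosSemidef (C₂ • (1 : Matrix (Fin n) (Fin n) ℝ) - hessianMatrix w x)) ∧
        (∀ α ∈ Set.Icc (0 : ℝ) 1, ∀ x ∈ {z : Euc n | u z < u 0 + L / 2},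
          ∀ y ∈ {z : Euc n | u z < u 0 + L / 2},
            ‖iteratedFDeriv ℝ 2 w x - iteratedFDeriv ℝ 2 w y‖ ≤
              C₂ ^ (1 - α) * C₃ ^ α * ‖x - y‖ ^ α) ∧
        ‖gradient w 0‖ ≤ (n : ℝ) * C₂ * Real.sqrt (2 / c₂) * Real.sqrt δ := by
  obtain ⟨c, C, C3, d, K, hc, hC, hC3, hd, hK, hest⟩ := SPF.Sol.interior_est n hn (1 / 64) (by norm_num)
  have hKd : 0 < K / d := div_pos hK hd
  have hM0 : 0 < C + 1 + 2 * K / d := by positivity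
  refine ⟨min c 1, 2 * C + (C + 1 + 2 * K / d) + 1, C3, lt_min hc one_pos, by positivity, hC3, ?_⟩
  intro L hL ξ u g w δ hsc hu2 hb1 hbn hgr hufr hudet hg0 hgδ hδ hwc hw hwcl hwdet hwfr
  have hnR : (2 : ℝ) ≤ n := by exact_mod_cast hn
  have hδ20 : δ ≤ 1 / 20 := by
    have : ((n : ℝ) ^ 2)⁻¹ ≤ 1 / 4 := by
      rw [inv_eq_one_div]
      exact one_div_le_one_div_of_le (by norm_num) (by nlinarith)
    linarith
  have h0S' : (0 : Euc n) ∈ {z : Euc n | u z < u 0 + L} := by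
    show u 0 < u 0 + L
    linarith
  have hδ0 : 0 ≤ δ := by
    have := hgδ 0 h0S'
    rw [hg0] at this
    simpa using this
  have hudet' : ∀ z ∈ {z : Euc n | u z < u 0 + L}, (SPF.bm (SPF.hs u z)).det = g z ^ n := by
    intro z hz
    rw [← SPF.hessianMatrix_eq]
    exact hudet z hz
  have hwdet' : ∀ z ∈ {z : Euc n | u z < u 0 + L}, (SPF.bm (SPF.hs w z)).det = 1 := by
    intro z hz
    rw [← SPF.hessianMatrix_eq]
    exact hwdet z hz
  have hlev : u 0 + L = 0 := by
    refine SPF.level_zero hn hu2.continuousOn hb1 hbn hufr ?_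
    intro z hz
    rw [hudet' z hz]
    have := abs_le.1 (hgδ z hz)
    exact pow_ne_zero _ (by linarith)
  have hhalf : ∀ z, z ∈ {z : Euc n | u z < u 0 + L / 2} → z ∈ {z : Euc n | u z < u 0 + L} := by
    intro z hz
    have : u z < u 0 + L / 2 := hz
    show u z < u 0 + L
    linarith
  have hSlt : ∀ z ∈ {z : Euc n | u z < u 0 + L}, u z < 0 := by
    intro z hz
    rw [← hlev]; exact hz
  set S : Set (Euc n) := {z : Euc n | u z < u 0 + L} with hS
  have op : IsOpen S := by
    rw [← interior_eq_iff_isOpen]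
    refine Set.Subset.antisymm interior_subset fun z hz => ?_
    by_contra hcon
    have h1 := hufr z ⟨subset_closure hz, hcon⟩
    have h2 := hSlt z hz
    linarith
  have cvx : Convex ℝ S := by
    have h1 := hsc.convexOn.convex_lt (u 0 + L)
    have h2 : S = {x | x ∈ closure S ∧ u x < u 0 + L} := by
      ext z
      exact ⟨fun h => ⟨subset_closure h, h⟩, fun h => h.2⟩
    rw [h2]
    exact h1
  have huc : ConvexOn ℝ S u := hsc.convexOn.subset subset_closure cvx
  have huS : ContDiffOn ℝ 2 u S := hu2.mono subset_closure
  obtain ⟨sol, c1, c2, hξ⟩ := SPF.core hn op cvx hb1 hbn huc huS hu2.continuousOn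
    (fun z hz => (hSlt z hz).le) hufr hudet' hgδ hδ0 hδ20 hwc hw hwcl hwdet' hwfr
  have hmin : ∀ z ∈ S, u 0 ≤ u z := by
    intro z hz
    have hd0 : DifferentiableAt ℝ u 0 :=
      (huS.contDiffAt (op.mem_nhds h0S')).differentiableAt (by norm_num)
    have h1 := SPF.convex_grad huc h0S' hz hd0
    have h2 : fderiv ℝ u 0 = 0 := by
      have h3 : (InnerProductSpace.toDual ℝ (Euc n)).symm (fderiv ℝ u 0) = 0 := hgr
      simpa using h3
    rw [h2] at h1
    simpa using h1
  have hξS : ξ ∈ S := hb1 (Metric.mem_ball_self one_pos)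
  have hL4 : 1 / 4 ≤ L := by
    have h1 := hmin ξ hξS
    have h2 := c2 ξ hξS
    nlinarith
  have hwhalf : ∀ z, z ∈ {z : Euc n | u z < u 0 + L / 2} → w z ≤ -(4 * (1 / 64)) := by
    intro z hz
    have h1 : u z < u 0 + L / 2 := hz
    have h2 := c1 z (hhalf z hz)
    have h3 := sol.neg z (hhalf z hz)
    nlinarith
  have ha : ∀ z ∈ S, |u z - w z| ≤ (n : ℝ) ^ 2 * δ / 2 := by
    intro z hz
    have h1 := c1 z hz
    have h2 := c2 z hz
    have h3 := sol.lower hz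
    have h4 : δ * (-(n : ℝ) ^ 2 / 2) ≤ δ * w z := mul_le_mul_of_nonneg_left h3 hδ0
    rw [abs_le]
    constructor <;> nlinarith
  obtain ⟨e1, e2, e3, e4⟩ := hest S ξ w sol
  refine ⟨ha, ?_, ?_, ?_⟩
  · intro x hx
    have hxS := hhalf x hx
    obtain ⟨f1, f2, f3⟩ := e1 x hxS (by linarith [hwhalf x hx])
    rw [SPF.hessianMatrix_eq]
    constructor
    · refine (SPF.bm_lower (sol.symm hxS)).2 fun e => le_trans ?_ (f1 e)
      exact mul_le_mul_of_nonneg_right (min_le_left _ _) (sq_nonneg _)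
    · refine (SPF.bm_upper (sol.symm hxS)).2 fun e => (f2 e).trans ?_
      exact mul_le_mul_of_nonneg_right (by linarith) (sq_nonneg _)
  · intro α hα x hx y hy
    refine (SPF.iter_norm w x y).trans ?_
    have hHc : Convex ℝ {z : Euc n | u z < u 0 + L / 2} := by
      have h1 := huc.convex_lt (u 0 + L / 2)
      have h2 : {z : Euc n | u z < u 0 + L / 2} = {x | x ∈ S ∧ u x < u 0 + L / 2} := by
        ext z
        exact ⟨fun h => ⟨hhalf z h, h⟩, fun h => h.2⟩
      rw [h2]
      exact h1
    refine SPF.holder_interp (norm_nonneg (SPF.hs w x - SPF.hs w y)) (by positivity) hC3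
      (norm_nonneg (x - y)) ?_ ?_ hα
    · have h1 := (e1 x (hhalf x hx) (by linarith [hwhalf x hx])).2.2
      have h2 := (e1 y (hhalf y hy) (by linarith [hwhalf y hy])).2.2
      have h3 := norm_sub_le (SPF.hs w x) (SPF.hs w y)
      linarith
    · refine hHc.norm_image_sub_le_of_norm_fderiv_le (𝕜 := ℝ) ?_ ?_ hy hx
      · intro z hz
        exact SPF.smooth_diff' op (SPF.hs_contDiffOn op hw) (hhalf z hz)
      · intro z hz
        exact e2 z (hhalf z hz) (by linarith [hwhalf z hz])
  · have h0h : (0 : Euc n) ∈ {z : Euc n | u z < u 0 + L / 2} := by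
      show u 0 < u 0 + L / 2
      linarith
    have hw0 := hwhalf 0 h0h
    have hgrad := SPF.grad_est sol (ε := 1 / 64) (m := (n : ℝ) ^ 2 * δ) hC hd hK h0S'
      (e3 0 h0S' (by linarith)) hw0 (fun x hx h => (e1 x hx h).2.2) (e4 0 h0S' (by linarith))
      (fun y hy => by
        have h1 := abs_le.1 (ha y hy)
        have h2 := abs_le.1 (ha 0 h0S')
        have h3 := hmin y hy
        linarith)
    set M := C + 1 + 2 * K / d with hM
    have hs1 : 1 ≤ Real.sqrt (2 / min c 1) := by
      rw [Real.one_le_sqrt, le_div_iff₀ (lt_min hc one_pos)]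
      linarith [min_le_right c 1]
    have hsδ : Real.sqrt δ ^ 2 = δ := Real.sq_sqrt hδ0
    have hmain : ‖gradient w 0‖ ≤ (n : ℝ) * (2 * C + M + 1) * Real.sqrt δ := by
      refine abs_le_of_sq_le_sq' ?_ (by positivity) |>.2
      refine hgrad.trans ?_
      rw [mul_pow, mul_pow, hsδ]
      have h1 : 4 * M ≤ (2 * C + M + 1) ^ 2 := by nlinarith [sq_nonneg (M - 1)]
      have h2 : 0 ≤ (n : ℝ) ^ 2 * δ := by positivity
      nlinarith [mul_le_mul_of_nonneg_right h1 h2]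
    refine hmain.trans ?_
    have h5 : (n : ℝ) * (2 * C + M + 1) ≤ (n : ℝ) * (2 * C + M + 1) * Real.sqrt (2 / min c 1) :=
      le_mul_of_one_le_right (by positivity) hs1
    exact mul_le_mul_of_nonneg_right h5 (Real.sqrt_nonneg _)
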